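/- arXiv:1804.09091 — 3 statements merged into one kernel-verified Lean document; each statement's English description precedes it below -/
import Mathlib

section
/- Let t1 and t2 be coprime positive integers. The average size of all partitions that are simultaneously t1-core and t2-core equals (t1-1)(t2-1)(t1+t2+1)/24. -/
def hook (Y : YoungDiagram) (i j : ℕ) : ℕ :=
  (Y.rowLen i - j) + (Y.colLen j - i) - 1

def IsCore (Y : YoungDiagram) (t : ℕ) : Prop :=
  ∀ c ∈ Y.cells, ¬ (t ∣ hook Y c.1 c.2)

def DistinctParts (Y : YoungDiagram) : Prop :=
  ∀ i : ℕ, 0 < Y.rowLen (i + 1) → Y.rowLen (i + 1) < Y.rowLen i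

def betaSet (Y : YoungDiagram) : Finset ℕ :=
  (Finset.range (Y.colLen 0)).image (fun i => Y.rowLen i + (Y.colLen 0 - 1 - i))


lemma rl_pos {Y : YoungDiagram} {i : ℕ} : 0 < Y.rowLen i ↔ i < Y.colLen 0 := by
  rw [← YoungDiagram.mem_iff_lt_rowLen, YoungDiagram.mem_iff_lt_colLen]

lemma rl_cl {Y : YoungDiagram} {i j : ℕ} : j < Y.rowLen i ↔ i < Y.colLen j := by
  rw [← YoungDiagram.mem_iff_lt_rowLen, YoungDiagram.mem_iff_lt_colLen]

lemma mem_beta {Y : YoungDiagram} {x : ℕ} :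
    x ∈ betaSet Y ↔ ∃ i < Y.colLen 0, Y.rowLen i + (Y.colLen 0 - 1 - i) = x := by
  simp [betaSet]

/-- Gaps below a bead correspond to hooks. -/
lemma core_iff (Y : YoungDiagram) (t : ℕ) (ht : 0 < t) :
    IsCore Y t ↔ ∀ x ∈ betaSet Y, t ≤ x → x - t ∈ betaSet Y := by
  constructor
  · intro hc x hx htx
    by_contra hg
    obtain ⟨i, hi, rfl⟩ := mem_beta.1 hx
    set n := Y.colLen 0 with hn
    set g := Y.rowLen i + (n - 1 - i) - t with hgdef
    have hex : ∃ k, Y.rowLen k + n ≤ g + k := by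
      refine ⟨n, ?_⟩
      have : ¬ 0 < Y.rowLen n := by rw [rl_pos]; omega
      omega
    classical
    obtain ⟨k, hk, hmin⟩ : ∃ k, Y.rowLen k + n ≤ g + k ∧ ∀ i < k, ¬ (Y.rowLen i + n ≤ g + i) :=
      ⟨Nat.find hex, Nat.find_spec hex, fun i hi => Nat.find_min hex hi⟩
    have hkn : k ≤ n := by
      by_contra hlt
      have := hmin n (by omega)
      have h0 : ¬ 0 < Y.rowLen n := by rw [rl_pos]; omega
      omega
    have hjk : ∀ i < k, g + k - n < Y.rowLen i := by
      intro i hi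
      have h1 := hmin (k-1) (by omega)
      have h2 : Y.rowLen (k-1) + (n - 1 - (k-1)) ≠ g := by
        intro he
        exact hg (mem_beta.2 ⟨k-1, by omega, he⟩)
      have := Y.rowLen_anti i (k-1) (by omega)
      omega
    have hcl : Y.colLen (g + k - n) = k := by
      apply le_antisymm
      · by_contra hlt
        have := (rl_cl (Y := Y) (i := k) (j := g + k - n)).2 (by omega)
        omega
      · by_contra hlt
        have := (rl_cl (Y := Y) (i := Y.colLen (g+k-n)) (j := g + k - n)).1 (hjk _ (by omega))
        omega
    have hnk : n ≤ g + k := by omega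
    have hcell : (g + k - n) < Y.rowLen i := by
      by_contra hlt
      have h3 : ¬ (i < Y.colLen (g+k-n)) := by rw [← rl_cl]; exact hlt
      omega
    refine hc (i, g + k - n) ((YoungDiagram.mem_cells _).2 (YoungDiagram.mem_iff_lt_rowLen.2 hcell)) ?_
    have h4 := rl_cl.1 hcell
    have : hook Y i (g + k - n) = t := by
      unfold hook
      omega
    simp only [this]
    exact dvd_rfl
  · rintro hB ⟨i, j⟩ hc ⟨q, hq⟩
    rw [YoungDiagram.mem_cells] at hc
    have h1 := YoungDiagram.mem_iff_lt_rowLen.1 hc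
    have h2 := YoungDiagram.mem_iff_lt_colLen.1 hc
    have h0 : i < Y.colLen 0 := rl_pos.1 (by omega)
    have hcn : Y.colLen j ≤ Y.colLen 0 := Y.colLen_anti 0 j (by omega)
    simp only [hook] at hq
    have hit : ∀ q x, x ∈ betaSet Y → t * q ≤ x → x - t * q ∈ betaSet Y := by
      intro q
      induction q with
      | zero => intro x hx _; simpa using hx
      | succ q ih =>
        intro x hx hle
        rw [Nat.mul_succ] at hle ⊢
        rw [← Nat.sub_sub]
        exact hB _ (ih x hx (by omega)) (by omega)
    have h3 := hit q _ (mem_beta.2 ⟨i, h0, rfl⟩) (by omega)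
    obtain ⟨k, hk, hk2⟩ := mem_beta.1 h3
    have h5 : k < Y.colLen j ↔ j < Y.rowLen k := rl_cl.symm
    by_cases h6 : j < Y.rowLen k
    · have := h5.2 h6
      omega
    · have := fun hh => h6 (h5.1 hh)
      omega

lemma beta_injOn (Y : YoungDiagram) :
    Set.InjOn (fun i => Y.rowLen i + (Y.colLen 0 - 1 - i)) (Finset.range (Y.colLen 0)) := by
  intro i hi j hj hij
  simp only [Finset.coe_range, Set.mem_Iio] at hi hj hij
  rcases lt_trichotomy i j with h | h | h
  · have := Y.rowLen_anti i j h.le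
    omega
  · exact h
  · have := Y.rowLen_anti j i h.le
    omega

lemma card_beta (Y : YoungDiagram) : (betaSet Y).card = Y.colLen 0 := by
  unfold betaSet
  rw [Finset.card_image_of_injOn (beta_injOn Y), Finset.card_range]

lemma card_eq_sum_rowLen (Y : YoungDiagram) : Y.card = ∑ i ∈ Finset.range (Y.colLen 0), Y.rowLen i := by
  have := Finset.card_eq_sum_card_fiberwise (s := Y.cells) (t := Finset.range (Y.colLen 0)) (f := Prod.fst) (by
    rintro ⟨i, j⟩ hc
    have h1 := YoungDiagram.mem_iff_lt_rowLen.1 ((YoungDiagram.mem_cells _).1 (Finset.mem_coe.1 hc))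
    simp only [Finset.coe_range, Set.mem_Iio]
    exact rl_pos.1 (by omega))
  unfold YoungDiagram.card
  rw [this]
  apply Finset.sum_congr rfl
  intro i _
  rw [YoungDiagram.rowLen_eq_card]
  rfl

lemma size_beta (Y : YoungDiagram) :
    (Y.card : ℚ) = (∑ x ∈ betaSet Y, (x : ℚ)) - ((betaSet Y).card : ℚ) * (((betaSet Y).card : ℚ) - 1) / 2 := by
  rw [card_beta, card_eq_sum_rowLen]
  unfold betaSet
  rw [Finset.sum_image (beta_injOn Y)]
  push_cast
  rw [Finset.sum_add_distrib]
  have : ∀ n : ℕ, ∑ x ∈ Finset.range n, ((n - 1 - x : ℕ) : ℚ) = (n : ℚ) * (n - 1) / 2 := by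
    intro n
    rw [Finset.sum_range_reflect (fun x => (x : ℚ)) n]
    induction n with
    | zero => simp
    | succ n ih => rw [Finset.sum_range_succ, ih]; push_cast; ring
  rw [this]
  ring

lemma beta_inj {Y Y' : YoungDiagram} (h : betaSet Y = betaSet Y') : Y = Y' := by
  have hn : Y.colLen 0 = Y'.colLen 0 := by rw [← card_beta, ← card_beta, h]
  have key : ∀ Z : YoungDiagram, StrictMono (fun i : Fin (Z.colLen 0) => Z.rowLen (Z.colLen 0 - 1 - i) + i) := by
    intro Z i j hij
    have := Z.rowLen_anti (Z.colLen 0 - 1 - j) (Z.colLen 0 - 1 - i) (by omega)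
    have : (i : ℕ) < j := hij
    simp only
    omega
  have hr : ∀ Z : YoungDiagram, Set.range (fun i : Fin (Z.colLen 0) => Z.rowLen (Z.colLen 0 - 1 - i) + i) = (betaSet Z : Set ℕ) := by
    intro Z
    ext x
    simp only [Set.mem_range, Finset.mem_coe, mem_beta]
    constructor
    · rintro ⟨i, hi⟩
      refine ⟨Z.colLen 0 - 1 - i, by omega, ?_⟩
      rw [← hi]
      congr 1
      omega
    · rintro ⟨i, hi, hx⟩
      refine ⟨⟨Z.colLen 0 - 1 - i, by omega⟩, ?_⟩
      simp only
      rw [← hx]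
      congr 2
      omega
  have h1 := key Y
  have h2 := key Y'
  have r1 := hr Y
  have r2 := hr Y'
  have hrow : ∀ i, Y.rowLen i = Y'.rowLen i := by
    intro i
    by_cases hi : i < Y.colLen 0
    · rw [← h, ← r1, ← hn] at r2
      rw [← hn] at h2
      have := (StrictMono.range_inj h2 h1).1 r2
      have := congrFun this ⟨Y.colLen 0 - 1 - i, by omega⟩
      simp only at this
      rw [show Y.colLen 0 - 1 - (Y.colLen 0 - 1 - i) = i by omega] at this
      omega
    · have h3 : ¬ 0 < Y.rowLen i := by rw [rl_pos]; exact hi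
      have h4 : ¬ 0 < Y'.rowLen i := by rw [rl_pos, ← hn]; exact hi
      omega
  ext ⟨i, j⟩
  rw [YoungDiagram.mem_cells, YoungDiagram.mem_cells, YoungDiagram.mem_iff_lt_rowLen,
    YoungDiagram.mem_iff_lt_rowLen, hrow]

lemma beta_zero (Y : YoungDiagram) : 0 ∉ betaSet Y := by
  intro h
  obtain ⟨i, hi, h⟩ := mem_beta.1 h
  have := rl_pos.2 hi
  omega

lemma beta_surj (B : Finset ℕ) (h0 : 0 ∉ B) : ∃ Y, betaSet Y = B := by
  set n := B.card with hn
  let e := B.orderEmbOfFin hn.symm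
  have hemem : ∀ i, e i ∈ B := fun i => Finset.orderEmbOfFin_mem B hn.symm i
  have hsucc : ∀ i j : Fin n, i < j → e i < e j := fun i j h => e.strictMono h
  have hdiff : ∀ d (i j : Fin n), (j : ℕ) = i + d → e i + d ≤ e j := by
    intro d
    induction d with
    | zero =>
      intro i j h
      have : i = j := Fin.ext (by omega)
      simp [this]
    | succ d ih =>
      intro i j h
      have := ih i ⟨i + d, by omega⟩ rfl
      have := hsucc ⟨i + d, by omega⟩ j (by rw [Fin.lt_def]; simp only; omega)
      omega
  have hlow : ∀ i : Fin n, (i : ℕ) + 1 ≤ e i := by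
    intro i
    have h1 := hdiff i ⟨0, i.pos⟩ i (by simp)
    have h2 : e ⟨0, i.pos⟩ ≠ 0 := fun h => h0 (h ▸ hemem _)
    omega
  let f : Fin n → ℕ := fun i => e (Fin.rev i) - (n - 1 - i)
  have hf : Antitone f := by
    intro i j hij
    have hij' : (i : ℕ) ≤ j := hij
    have := hdiff (j - i) (Fin.rev j) (Fin.rev i) (by simp only [Fin.val_rev]; omega)
    simp only [f]
    omega
  have hfpos : ∀ i, 0 < f i := by
    intro i
    have := hlow (Fin.rev i)
    simp only [Fin.val_rev] at this
    simp only [f]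
    omega
  have hw : (List.ofFn f).SortedGE := hf.sortedGE_ofFn
  have hrl : ∀ i (hi : i < n), (YoungDiagram.ofRowLens _ hw).rowLen i = f ⟨i, hi⟩ := by
    intro i hi
    have := YoungDiagram.rowLen_ofRowLens (hw := hw) ⟨i, by simpa using hi⟩
    simpa using this
  have hcl : (YoungDiagram.ofRowLens _ hw).colLen 0 = n := by
    have := YoungDiagram.rowLens_length_ofRowLens (hw := hw) (by
      intro x hx
      obtain ⟨i, rfl⟩ := (List.mem_ofFn' _ _).1 hx
      exact hfpos i)
    simpa using this
  refine ⟨YoungDiagram.ofRowLens _ hw, ?_⟩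
  apply Finset.eq_of_subset_of_card_le
  · intro x hx
    obtain ⟨i, hi, rfl⟩ := mem_beta.1 hx
    rw [hcl] at hi ⊢
    rw [hrl i hi]
    have := hlow (Fin.rev ⟨i, hi⟩)
    simp only [Fin.val_rev] at this
    have h2 : f ⟨i, hi⟩ + (n - 1 - i) = e (Fin.rev ⟨i, hi⟩) := by
      simp only [f]
      omega
    rw [h2]
    exact hemem _
  · rw [card_beta, hcl]

/-- Weak compositions of `b` indexed by `ι`. -/
abbrev Comp (ι : Type) [Fintype ι] [DecidableEq ι] (b : ℕ) : Finset (ι → ℕ) :=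
  Finset.piAntidiag (Finset.univ : Finset ι) b

section Moments
variable {ι : Type} [Fintype ι] [DecidableEq ι]

lemma mem_Comp {b : ℕ} {z : ι → ℕ} : z ∈ Comp ι b ↔ ∑ i, z i = b := by
  simp [Comp, Finset.mem_piAntidiag]

lemma sum_perm (b : ℕ) (σ : Equiv.Perm ι) (f : (ι → ℕ) → ℚ) :
    ∑ z ∈ Comp ι b, f (z ∘ σ) = ∑ z ∈ Comp ι b, f z := by
  refine Finset.sum_nbij' (fun z => z ∘ σ) (fun z => z ∘ σ.symm) ?_ ?_ ?_ ?_ ?_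
  · intro z hz
    rw [mem_Comp] at hz ⊢
    rw [← hz]
    exact Equiv.sum_comp σ z
  · intro z hz
    rw [mem_Comp] at hz ⊢
    rw [← hz]
    exact Equiv.sum_comp σ.symm z
  · intro z _
    funext i
    simp
  · intro z _
    funext i
    simp
  · intro z _
    rfl

lemma sum_shift (b : ℕ) (i : ι) (g : (ι → ℕ) → ℚ) :
    ∑ z ∈ Comp ι (b + 1), (z i : ℚ) * g z =
      ∑ y ∈ Comp ι b, ((y i : ℚ) + 1) * g (y + Pi.single i 1) := by
  symm
  refine Finset.sum_of_injOn (fun y => y + Pi.single i 1) ?_ ?_ ?_ ?_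
  · intro y _ y' _ h
    exact add_right_cancel h
  · intro y hy
    rw [Finset.mem_coe, mem_Comp] at hy ⊢
    simp [Finset.sum_add_distrib, hy]
  · intro z hz hn
    rw [mem_Comp] at hz
    by_cases h0 : z i = 0
    · simp [h0]
    · exfalso
      apply hn
      have hadd : (z - Pi.single i 1) + Pi.single i 1 = z := by
        funext k
        by_cases hk : k = i
        · subst hk
          simp
          omega
        · simp [hk]
      refine ⟨z - Pi.single i 1, ?_, hadd⟩
      rw [Finset.mem_coe, mem_Comp]
      have : ∑ k, ((z - Pi.single i 1) + Pi.single i 1 : ι → ℕ) k = b + 1 := by rw [hadd, hz]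
      simp only [Pi.add_apply, Finset.sum_add_distrib] at this
      simpa using this
  · intro y _
    simp

lemma sum_rel (b : ℕ) {i j : ι} (hij : i ≠ j) :
    ∑ z ∈ Comp ι b, (z i : ℚ) * z j =
      ((∑ z ∈ Comp ι b, (z i : ℚ) ^ 2) - ∑ z ∈ Comp ι b, (z i : ℚ)) / 2 := by
  have key : ∑ z ∈ Comp ι b, (z i : ℚ) * (((z i : ℚ) - 1) * ((z j : ℚ) + 1)) =
      ∑ z ∈ Comp ι b, (z j : ℚ) * (((z i : ℚ) + 1) * (z i : ℚ)) := by
    cases b with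
    | zero =>
      apply Finset.sum_congr rfl
      intro z hz
      rw [mem_Comp, Finset.sum_eq_zero_iff] at hz
      simp [hz i (Finset.mem_univ _)]
    | succ b =>
      rw [sum_shift b i (fun z => ((z i : ℚ) - 1) * ((z j : ℚ) + 1)),
        sum_shift b j (fun z => ((z i : ℚ) + 1) * (z i : ℚ))]
      apply Finset.sum_congr rfl
      intro y _
      simp [hij, hij.symm]
      ring
  have h2 : ∑ z ∈ Comp ι b, ((z i : ℚ) * (((z i : ℚ) - 1) * ((z j : ℚ) + 1)) -
      (z j : ℚ) * (((z i : ℚ) + 1) * (z i : ℚ))) = 0 := by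
    rw [Finset.sum_sub_distrib, key, sub_self]
  have h3 : ∑ z ∈ Comp ι b, ((z i : ℚ) * (((z i : ℚ) - 1) * ((z j : ℚ) + 1)) -
      (z j : ℚ) * (((z i : ℚ) + 1) * (z i : ℚ))) =
      ∑ z ∈ Comp ι b, ((z i : ℚ) ^ 2 - (z i : ℚ) - 2 * ((z i : ℚ) * z j)) := by
    apply Finset.sum_congr rfl
    intro y _
    ring
  rw [h3, Finset.sum_sub_distrib, Finset.sum_sub_distrib, ← Finset.mul_sum] at h2
  linarith

lemma sum_coord (b : ℕ) (i j : ι) (f : ℕ → ℚ) :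
    ∑ z ∈ Comp ι b, f (z i) = ∑ z ∈ Comp ι b, f (z j) := by
  have := sum_perm b (Equiv.swap i j) (fun z => f (z i))
  simp only [Function.comp, Equiv.swap_apply_left] at this
  exact this.symm

lemma moment_one (b : ℕ) (i0 : ι) (S : Finset ι) :
    ∑ z ∈ Comp ι b, (∑ i ∈ S, (z i : ℚ)) = S.card * ∑ z ∈ Comp ι b, (z i0 : ℚ) := by
  rw [Finset.sum_comm]
  rw [Finset.sum_congr rfl (fun i _ => sum_coord b i i0 (fun x => (x : ℚ)))]
  simp

lemma moment_two (b : ℕ) (i0 : ι) (S : Finset ι) :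
    ∑ z ∈ Comp ι b, (∑ i ∈ S, (z i : ℚ)) ^ 2 = S.card * (∑ z ∈ Comp ι b, (z i0 : ℚ) ^ 2) +
      S.card * ((S.card : ℚ) - 1) *
        (((∑ z ∈ Comp ι b, (z i0 : ℚ) ^ 2) - ∑ z ∈ Comp ι b, (z i0 : ℚ)) / 2) := by
  set A := ∑ z ∈ Comp ι b, (z i0 : ℚ) ^ 2 with hA
  set L := ∑ z ∈ Comp ι b, (z i0 : ℚ) with hL
  have hAi : ∀ i, ∑ z ∈ Comp ι b, (z i : ℚ) ^ 2 = A := fun i => sum_coord b i i0 (fun x => (x : ℚ) ^ 2)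
  have hLi : ∀ i, ∑ z ∈ Comp ι b, (z i : ℚ) = L := fun i => sum_coord b i i0 (fun x => (x : ℚ))
  have hC : ∀ i j, ∑ z ∈ Comp ι b, (z i : ℚ) * z j =
      (A - L) / 2 + if i = j then A - (A - L) / 2 else 0 := by
    intro i j
    by_cases hij : i = j
    · subst hij
      rw [if_pos rfl, ← hAi i]
      simp only [pow_two]
      ring
    · rw [if_neg hij, sum_rel b hij, hAi, hLi, add_zero]
  calc ∑ z ∈ Comp ι b, (∑ i ∈ S, (z i : ℚ)) ^ 2
      = ∑ z ∈ Comp ι b, ∑ i ∈ S, ∑ j ∈ S, (z i : ℚ) * z j := by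
        apply Finset.sum_congr rfl
        intro z _
        rw [pow_two, Finset.sum_mul_sum]
    _ = ∑ i ∈ S, ∑ j ∈ S, ∑ z ∈ Comp ι b, (z i : ℚ) * z j := by
        rw [Finset.sum_comm]
        apply Finset.sum_congr rfl
        intro i _
        rw [Finset.sum_comm]
    _ = ∑ i ∈ S, (S.card * ((A - L) / 2) + (A - (A - L) / 2)) := by
        apply Finset.sum_congr rfl
        intro i hi
        simp only [hC]
        rw [Finset.sum_add_distrib, Finset.sum_ite_eq]
        simp [hi]
    _ = _ := by
        simp
        ring

lemma variance_block (b : ℕ) (i0 : ι) (S : Finset ι) :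
    ∑ z ∈ Comp ι b, ((S.card : ℚ) * b - (Fintype.card ι : ℚ) * ∑ i ∈ S, (z i : ℚ)) ^ 2 =
      (Comp ι b).card * (S.card * ((Fintype.card ι : ℚ) - S.card)) *
        (b * ((Fintype.card ι : ℚ) + b) / ((Fintype.card ι : ℚ) + 1)) := by
  have hu : ∀ z ∈ Comp ι b, (∑ i, (z i : ℚ)) = b := by
    intro z hz
    rw [mem_Comp] at hz
    exact_mod_cast hz
  have e1 := moment_one b i0 Finset.univ
  have e2 := moment_two b i0 Finset.univ
  rw [Finset.sum_congr rfl hu] at e1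
  rw [Finset.sum_congr rfl (fun z hz => by rw [hu z hz])] at e2
  have e3 := moment_one b i0 S
  have e4 := moment_two b i0 S
  simp only [Finset.sum_const, nsmul_eq_mul, Finset.card_univ] at e1 e2
  set A := ∑ z ∈ Comp ι b, (z i0 : ℚ) ^ 2 with hA
  set L := ∑ z ∈ Comp ι b, (z i0 : ℚ) with hL
  set a : ℚ := (Fintype.card ι : ℚ) with ha
  set d : ℚ := (S.card : ℚ) with hd
  set N : ℚ := ((Comp ι b).card : ℚ) with hN
  have hexp : ∑ z ∈ Comp ι b, (d * b - a * ∑ i ∈ S, (z i : ℚ)) ^ 2 =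
      N * (d * b) ^ 2 - 2 * d * b * a * (∑ z ∈ Comp ι b, ∑ i ∈ S, (z i : ℚ)) +
        a ^ 2 * ∑ z ∈ Comp ι b, (∑ i ∈ S, (z i : ℚ)) ^ 2 := by
    rw [Finset.mul_sum, Finset.mul_sum]
    have : N * (d * b) ^ 2 = ∑ z ∈ Comp ι b, (d * b) ^ 2 := by simp [hN]
    rw [this, ← Finset.sum_sub_distrib, ← Finset.sum_add_distrib]
    apply Finset.sum_congr rfl
    intro z _
    ring
  rw [hexp, e3, e4]
  have hapos : 0 < a := by
    rw [ha]
    exact_mod_cast Fintype.card_pos_iff.2 ⟨i0⟩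
  have hL' : L = N * b / a := by field_simp; linarith
  have hA' : A = N * (2 * b ^ 2 + (a - 1) * b) / (a * (a + 1)) := by
    rw [hL'] at e2
    field_simp at e2 ⊢
    linarith
  rw [hL', hA']
  field_simp
  ring

end Moments

/-- The height walk attached to a cyclic composition. -/
def walk (a b : ℕ) (z : ZMod a → ℕ) (n : ℕ) : ℤ :=
  n * b - a * ∑ k ∈ Finset.range n, (z (k : ZMod a) : ℤ)

def rot (a : ℕ) (r : ℕ) (z : ZMod a → ℕ) : ZMod a → ℕ := z ∘ Equiv.addRight (r : ZMod a)

lemma walk_zero (a b : ℕ) (z : ZMod a → ℕ) : walk a b z 0 = 0 := by simp [walk]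

lemma walk_succ (a b : ℕ) (z : ZMod a → ℕ) (n : ℕ) :
    walk a b z (n + 1) = walk a b z n + b - a * z (n : ZMod a) := by
  simp only [walk, Finset.sum_range_succ]
  push_cast
  ring

lemma walk_rot (a b r : ℕ) (z : ZMod a → ℕ) (n : ℕ) :
    walk a b (rot a r z) n = walk a b z (n + r) - walk a b z r := by
  induction n with
  | zero => simp [walk_zero]
  | succ n ih =>
    rw [walk_succ, ih, show n + 1 + r = (n + r) + 1 by ring, walk_succ]
    simp [rot]
    ring

section Cyc
variable (a b : ℕ) [NeZero a]

lemma sum_range_zmod (f : ZMod a → ℤ) : ∑ k ∈ Finset.range a, f (k : ZMod a) = ∑ i, f i := by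
  refine Finset.sum_nbij' (fun k => (k : ZMod a)) (fun i => i.val) ?_ ?_ ?_ ?_ ?_
  · intro k _; simp
  · intro i _; simpa using ZMod.val_lt i
  · intro k hk; exact ZMod.val_cast_of_lt (by simpa using hk)
  · intro i _; simp
  · intro k _; rfl

lemma walk_a {z : ZMod a → ℕ} (hz : z ∈ Comp (ZMod a) b) : walk a b z a = 0 := by
  rw [mem_Comp] at hz
  unfold walk
  rw [sum_range_zmod a (fun i => (z i : ℤ))]
  rw [← hz]
  push_cast
  ring

lemma walk_add_a {z : ZMod a → ℕ} (hz : z ∈ Comp (ZMod a) b) (n : ℕ) :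
    walk a b z (n + a) = walk a b z n := by
  induction n with
  | zero => simp [walk_a a b hz, walk_zero]
  | succ n ih =>
    rw [show n + 1 + a = (n + a) + 1 by ring, walk_succ, walk_succ, ih]
    simp

lemma walk_mod {z : ZMod a → ℕ} (hz : z ∈ Comp (ZMod a) b) (n : ℕ) :
    walk a b z (n % a) = walk a b z n :=
  Function.Periodic.map_mod_nat (walk_add_a a b hz) n

lemma rot_mem {z : ZMod a → ℕ} (hz : z ∈ Comp (ZMod a) b) (r : ℕ) : rot a r z ∈ Comp (ZMod a) b := by
  rw [mem_Comp] at hz ⊢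
  rw [← hz]
  exact Equiv.sum_comp (Equiv.addRight (r : ZMod a)) z

lemma sum_range_periodic {M : Type} [AddCommMonoid M] (f : ℕ → M) (hf : ∀ n, f (n + a) = f n) (r : ℕ) :
    ∑ n ∈ Finset.range a, f (n + r) = ∑ n ∈ Finset.range a, f n := by
  induction r with
  | zero => simp
  | succ r ih =>
    rw [← ih]
    obtain ⟨c, rfl⟩ : ∃ c, a = c + 1 := ⟨a - 1, by have := NeZero.pos a; omega⟩
    rw [Finset.sum_range_succ, Finset.sum_range_succ' (fun n => f (n + r))]
    congr 1
    · apply Finset.sum_congr rfl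
      intro n _
      congr 1
      ring
    · rw [← hf (0 + r)]
      congr 1
      ring

/-- Rotation invariant quadratic energy. -/
def energy (a b : ℕ) (z : ZMod a → ℕ) : ℚ :=
  ∑ j ∈ Finset.range a, ∑ k ∈ Finset.range a, ((walk a b z j : ℚ) - walk a b z k) ^ 2

lemma energy_rot {z : ZMod a → ℕ} (hz : z ∈ Comp (ZMod a) b) (r : ℕ) :
    energy a b (rot a r z) = energy a b z := by
  unfold energy
  simp only [walk_rot]
  push_cast
  simp only [sub_sub_sub_cancel_right]
  rw [sum_range_periodic a (fun j => ∑ k ∈ Finset.range a,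
    ((walk a b z j : ℚ) - walk a b z (k + r)) ^ 2) (by intro n; simp only [walk_add_a a b hz])]
  apply Finset.sum_congr rfl
  intro j _
  exact sum_range_periodic a (fun k => ((walk a b z j : ℚ) - walk a b z k) ^ 2)
    (by intro n; simp only [walk_add_a a b hz]) r

open Classical in
/-- Rational Dyck paths. -/
noncomputable def Dyck (a b : ℕ) [NeZero a] : Finset (ZMod a → ℕ) :=
  (Comp (ZMod a) b).filter (fun z => ∀ n, 0 ≤ walk a b z n)

lemma mem_Dyck {z : ZMod a → ℕ} : z ∈ Dyck a b ↔ z ∈ Comp (ZMod a) b ∧ ∀ n, 0 ≤ walk a b z n := by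
  classical
  simp only [Dyck, Finset.mem_filter]

lemma mul_inj_mod {a b : ℕ} (h : Nat.Coprime a b) {n m : ℕ} (hn : n < a) (hm : m < a)
    (he : n * b % a = m * b % a) : n = m := by
  have h1 : n * b ≡ m * b [MOD a] := he
  have h2 := Nat.ModEq.cancel_right_of_coprime h h1
  rw [Nat.ModEq, Nat.mod_eq_of_lt hn, Nat.mod_eq_of_lt hm] at h2
  exact h2

lemma unique_rot (h : Nat.Coprime a b) {z : ZMod a → ℕ} (hz : z ∈ Comp (ZMod a) b) :
    ∃! r, r ∈ Finset.range a ∧ rot a r z ∈ Dyck a b := by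
  have ha := NeZero.pos a
  obtain ⟨r, hr, hmin⟩ := Finset.exists_min_image (Finset.range a) (fun n => walk a b z n) ⟨0, by simpa using ha⟩
  have hmin' : ∀ n, walk a b z r ≤ walk a b z n := by
    intro n
    rw [← walk_mod a b hz n]
    exact hmin _ (by simpa using Nat.mod_lt _ ha)
  refine ⟨r, ⟨hr, (mem_Dyck a b).2 ⟨rot_mem a b hz r, fun n => ?_⟩⟩, ?_⟩
  · rw [walk_rot]
    have := hmin' (n + r)
    omega
  · rintro s ⟨hs, hsD⟩
    have h1 := ((mem_Dyck a b).1 hsD).2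
    have hs2 : ∀ n, walk a b z s ≤ walk a b z n := by
      intro n
      have h2 := h1 (n + (a - s))
      rw [walk_rot, show n + (a - s) + s = n + a by
        have := Finset.mem_range.1 hs
        omega, walk_add_a a b hz] at h2
      omega
    have heq : walk a b z s = walk a b z r := le_antisymm (hs2 r) (hmin' s)
    apply mul_inj_mod h (Finset.mem_range.1 hs) (Finset.mem_range.1 hr)
    unfold walk at heq
    have : ((s * b : ℕ) : ℤ) ≡ ((r * b : ℕ) : ℤ) [ZMOD a] := by
      apply Int.ModEq.symm
      rw [Int.modEq_iff_dvd]
      push_cast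
      exact ⟨∑ k ∈ Finset.range s, (z (k : ZMod a) : ℤ) - ∑ k ∈ Finset.range r, (z (k : ZMod a) : ℤ),
        by rw [mul_sub]; linarith⟩
    exact (Int.natCast_modEq_iff.1 this)

lemma cycle_lemma (h : Nat.Coprime a b) (F : (ZMod a → ℕ) → ℚ)
    (hF : ∀ z ∈ Comp (ZMod a) b, ∀ r, F (rot a r z) = F z) :
    ∑ z ∈ Comp (ZMod a) b, F z = a * ∑ z ∈ Dyck a b, F z := by
  classical
  have h1 : ∀ z ∈ Comp (ZMod a) b, F z =
      ∑ r ∈ Finset.range a, if rot a r z ∈ Dyck a b then F (rot a r z) else 0 := by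
    intro z hz
    obtain ⟨r, ⟨hr, hrD⟩, hu⟩ := unique_rot a b h hz
    rw [Finset.sum_eq_single r]
    · rw [if_pos hrD, hF z hz]
    · intro s hs hsr
      rw [if_neg]
      intro hsD
      exact hsr (hu s ⟨hs, hsD⟩)
    · intro hn
      exact absurd hr hn
  rw [Finset.sum_congr rfl h1, Finset.sum_comm]
  have h2 : ∀ r ∈ Finset.range a, (∑ z ∈ Comp (ZMod a) b,
      if rot a r z ∈ Dyck a b then F (rot a r z) else 0) = ∑ z ∈ Dyck a b, F z := by
    intro r _
    have := sum_perm b (Equiv.addRight (r : ZMod a)) (fun z => if z ∈ Dyck a b then F z else 0)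
    unfold rot
    rw [this, ← Finset.sum_filter]
    apply Finset.sum_congr _ (fun _ _ => rfl)
    ext z
    rw [Finset.mem_filter, mem_Dyck]
    tauto
  rw [Finset.sum_congr rfl h2]
  simp

lemma sum_sq_walk {j k : ℕ} (hkj : k ≤ j) (hj : j < a) :
    ∑ z ∈ Comp (ZMod a) b, ((walk a b z j : ℚ) - walk a b z k) ^ 2 =
      ((Comp (ZMod a) b).card : ℚ) * (((j : ℚ) - k) * ((a : ℚ) - ((j : ℚ) - k))) *
        (b * ((a : ℚ) + b) / ((a : ℚ) + 1)) := by
  have hinj : Set.InjOn (fun i : ℕ => (i : ZMod a)) (Finset.Ico k j) := by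
    intro x hx y hy hxy
    simp only [Finset.coe_Ico, Set.mem_Ico] at hx hy
    have := congrArg ZMod.val hxy
    simp only at this
    rwa [ZMod.val_cast_of_lt (by omega), ZMod.val_cast_of_lt (by omega)] at this
  have hv := variance_block b (0 : ZMod a) ((Finset.Ico k j).image (fun i : ℕ => (i : ZMod a)))
  rw [Finset.card_image_of_injOn hinj, Nat.card_Ico, ZMod.card, Nat.cast_sub hkj] at hv
  rw [← hv]
  apply Finset.sum_congr rfl
  intro z _
  rw [Finset.sum_image hinj, Finset.sum_Ico_eq_sub _ hkj]
  unfold walk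
  push_cast
  ring

lemma sum_dist (n : ℕ) (a : ℚ) :
    ∑ j ∈ Finset.range n, ∑ k ∈ Finset.range j, (((j : ℚ) - k) * (a - ((j : ℚ) - k))) =
      a * ((n : ℚ) ^ 3 - n) / 6 - (n : ℚ) ^ 2 * ((n : ℚ) ^ 2 - 1) / 12 := by
  have hin : ∀ j : ℕ, ∑ k ∈ Finset.range j, (((j : ℚ) - k) * (a - ((j : ℚ) - k))) =
      a * (j * (j + 1) / 2) - j * (j + 1) * (2 * j + 1) / 6 := by
    intro j
    have : ∀ m : ℕ, ∀ c : ℚ, ∑ k ∈ Finset.range m, ((c - k) * (a - (c - k))) =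
        a * (m * c - m * (m - 1) / 2) - (m * c ^ 2 - c * (m * (m - 1)) + (m - 1) * m * (2 * m - 1) / 6) := by
      intro m c
      induction m with
      | zero => simp
      | succ m ih => rw [Finset.sum_range_succ, ih]; push_cast; ring
    rw [this]
    ring
  simp only [hin]
  induction n with
  | zero => simp
  | succ n ih => rw [Finset.sum_range_succ, ih]; push_cast; ring

lemma sum_sym (n : ℕ) (f : ℕ → ℕ → ℚ) (hs : ∀ i j, f i j = f j i) (h0 : ∀ i, f i i = 0) :
    ∑ j ∈ Finset.range n, ∑ k ∈ Finset.range n, f j k =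
      2 * ∑ j ∈ Finset.range n, ∑ k ∈ Finset.range j, f j k := by
  induction n with
  | zero => simp
  | succ n ih =>
    rw [Finset.sum_range_succ, Finset.sum_range_succ (fun j => ∑ k ∈ Finset.range j, f j k)]
    simp only [Finset.sum_range_succ _ n]
    rw [Finset.sum_add_distrib, ih, h0]
    rw [Finset.sum_congr rfl (fun i _ => hs i n)]
    ring

lemma sum_energy :
    ∑ z ∈ Comp (ZMod a) b, energy a b z =
      ((Comp (ZMod a) b).card : ℚ) * ((a : ℚ) ^ 2 * ((a : ℚ) ^ 2 - 1) / 6) *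
        (b * ((a : ℚ) + b) / ((a : ℚ) + 1)) := by
  unfold energy
  have h1 : ∀ z : ZMod a → ℕ, ∑ j ∈ Finset.range a, ∑ k ∈ Finset.range a,
      ((walk a b z j : ℚ) - walk a b z k) ^ 2 = 2 * ∑ j ∈ Finset.range a, ∑ k ∈ Finset.range j,
      ((walk a b z j : ℚ) - walk a b z k) ^ 2 := by
    intro z
    apply sum_sym a (fun j k => ((walk a b z j : ℚ) - walk a b z k) ^ 2)
    · intro i j; ring
    · intro i; ring
  simp only [h1]
  rw [← Finset.mul_sum, Finset.sum_comm]
  have h2 : ∀ j ∈ Finset.range a, ∑ z ∈ Comp (ZMod a) b, ∑ k ∈ Finset.range j,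
      ((walk a b z j : ℚ) - walk a b z k) ^ 2 = ∑ k ∈ Finset.range j,
      ((Comp (ZMod a) b).card : ℚ) * (((j : ℚ) - k) * ((a : ℚ) - ((j : ℚ) - k))) *
        (b * ((a : ℚ) + b) / ((a : ℚ) + 1)) := by
    intro j hj
    rw [Finset.sum_comm]
    apply Finset.sum_congr rfl
    intro k hk
    exact sum_sq_walk a b (Finset.mem_range.1 hk).le (Finset.mem_range.1 hj)
  rw [Finset.sum_congr rfl h2]
  simp only [← Finset.sum_mul, ← Finset.mul_sum]
  rw [sum_dist]
  ring

end Cyc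

/-- The finite set of gaps with given minimal non-gaps `W n` in the classes of `n * b`. -/
def gapSet (a : ℕ) (W : ℕ → ℕ) : Finset ℕ :=
  (Finset.range a).biUnion (fun n => (Finset.range (W n / a)).image (fun q => W n % a + q * a))

lemma mem_gapSet {a : ℕ} (ha : 0 < a) {W : ℕ → ℕ} {x : ℕ} :
    x ∈ gapSet a W ↔ ∃ n < a, x < W n ∧ x % a = W n % a := by
  simp only [gapSet, Finset.mem_biUnion, Finset.mem_range, Finset.mem_image]
  constructor
  · rintro ⟨n, hn, q, hq, rfl⟩
    refine ⟨n, hn, ?_, ?_⟩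
    · have h1 := Nat.mod_add_div (W n) a
      have h2 : a * (q + 1) ≤ a * (W n / a) := Nat.mul_le_mul_left a hq
      rw [Nat.mul_succ] at h2
      rw [Nat.mul_comm q a]
      omega
    · simp
  · rintro ⟨n, hn, hx, hm⟩
    refine ⟨n, hn, x / a, ?_, ?_⟩
    · have h1 := Nat.mod_add_div (W n) a
      have h2 := Nat.mod_add_div x a
      by_contra hc
      have h3 : a * (W n / a) ≤ a * (x / a) := Nat.mul_le_mul_left a (by omega)
      omega
    · rw [← hm, Nat.mul_comm]
      exact Nat.mod_add_div x a

lemma exists_class {a b : ℕ} (ha : 0 < a) (h : Nat.Coprime a b) (x : ℕ) :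
    ∃ n < a, n * b % a = x % a := by
  haveI : NeZero a := ⟨ha.ne'⟩
  refine ⟨((x : ZMod a) * (b : ZMod a)⁻¹).val, ZMod.val_lt _, ?_⟩
  rw [← ZMod.natCast_eq_natCast_iff']
  push_cast
  rw [ZMod.natCast_zmod_val, mul_assoc, mul_comm _ (b : ZMod a), ZMod.coe_mul_inv_eq_one b h.symm, mul_one]

lemma mem_gapSet_class {a b : ℕ} (ha : 0 < a) (h : Nat.Coprime a b) {W : ℕ → ℕ}
    (hW : ∀ n < a, W n % a = n * b % a) {x n : ℕ} (hn : n < a) (hx : n * b % a = x % a) :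
    x ∈ gapSet a W ↔ x < W n := by
  rw [mem_gapSet ha]
  constructor
  · rintro ⟨m, hm, hlt, hmod⟩
    rw [hW m hm, ← hx] at hmod
    rwa [mul_inj_mod h hn hm hmod]
  · intro hlt
    exact ⟨n, hn, hlt, by rw [hW n hn, hx]⟩

lemma sum_class {a b : ℕ} (ha : 0 < a) (h : Nat.Coprime a b) (f : ℕ → ℚ) :
    ∑ n ∈ Finset.range a, f (n * b % a) = ∑ r ∈ Finset.range a, f r := by
  refine Finset.sum_nbij (fun n => n * b % a) ?_ ?_ ?_ ?_
  · intro n _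
    simpa using Nat.mod_lt _ ha
  · intro n hn m hm he
    exact mul_inj_mod h (by simpa using hn) (by simpa using hm) he
  · intro r hr
    simp only [Finset.coe_range, Set.mem_Iio] at hr
    obtain ⟨n, hn, he⟩ := exists_class ha h r
    exact ⟨n, by simpa using hn, by simpa [Nat.mod_eq_of_lt hr] using he⟩
  · intro n _
    rfl

lemma sum_gapSet {a b : ℕ} (ha : 0 < a) (h : Nat.Coprime a b) {W : ℕ → ℕ}
    (hW : ∀ n < a, W n % a = n * b % a) (f : ℕ → ℚ) :
    ∑ x ∈ gapSet a W, f x =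
      ∑ n ∈ Finset.range a, ∑ q ∈ Finset.range (W n / a), f (W n % a + q * a) := by
  unfold gapSet
  rw [Finset.sum_biUnion]
  · apply Finset.sum_congr rfl
    intro n _
    rw [Finset.sum_image]
    intro p _ q _ hpq
    simp only [add_right_inj] at hpq
    exact Nat.eq_of_mul_eq_mul_right ha hpq
  · intro n hn m hm hnm
    simp only [Finset.coe_range, Set.mem_Iio] at hn hm
    simp only [Function.onFun]
    rw [Finset.disjoint_left]
    intro x hx hx'
    obtain ⟨p, _, rfl⟩ := Finset.mem_image.1 hx
    obtain ⟨q, _, he⟩ := Finset.mem_image.1 hx'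
    apply hnm
    have := congrArg (· % a) he
    simp only [Nat.add_mul_mod_self_right, Nat.mod_mod] at this
    rw [hW n hn, hW m hm] at this
    exact mul_inj_mod h hn hm this.symm

lemma size_gapSet {a b : ℕ} (ha : 0 < a) (h : Nat.Coprime a b) {W : ℕ → ℕ}
    (hW : ∀ n < a, W n % a = n * b % a) :
    (∑ x ∈ gapSet a W, (x : ℚ)) - ((gapSet a W).card : ℚ) * (((gapSet a W).card : ℚ) - 1) / 2 =
      (∑ j ∈ Finset.range a, ∑ k ∈ Finset.range a, ((W j : ℚ) - W k) ^ 2) / (4 * (a : ℚ) ^ 2) -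
        ((a : ℚ) ^ 2 - 1) / 24 := by
  have hcard : ((gapSet a W).card : ℚ) = ∑ n ∈ Finset.range a, ((W n / a : ℕ) : ℚ) := by
    have := sum_gapSet ha h hW (fun _ => 1)
    simpa using this
  have hsum : ∑ x ∈ gapSet a W, (x : ℚ) = ∑ n ∈ Finset.range a,
      (((W n / a : ℕ) : ℚ) * ((W n % a : ℕ) : ℚ) +
        a * (((W n / a : ℕ) : ℚ) * (((W n / a : ℕ) : ℚ) - 1) / 2)) := by
    rw [sum_gapSet ha h hW (fun x => (x : ℚ))]
    apply Finset.sum_congr rfl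
    intro n _
    generalize W n / a = Q
    generalize W n % a = r
    induction Q with
    | zero => simp
    | succ Q ih => rw [Finset.sum_range_succ, ih]; push_cast; ring
  have hWd : ∀ n, (W n : ℚ) = a * ((W n / a : ℕ) : ℚ) + ((W n % a : ℕ) : ℚ) := by
    intro n
    exact_mod_cast (Nat.div_add_mod (W n) a).symm
  have hR1 : ∑ n ∈ Finset.range a, ((W n % a : ℕ) : ℚ) = (a : ℚ) * (a - 1) / 2 := by
    rw [Finset.sum_congr rfl (fun n hn => by rw [hW n (Finset.mem_range.1 hn)]),
      sum_class ha h (fun x => (x : ℚ))]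
    clear * -
    induction a with
    | zero => simp
    | succ n ih => rw [Finset.sum_range_succ, ih]; push_cast; ring
  have hR2 : ∑ n ∈ Finset.range a, ((W n % a : ℕ) : ℚ) ^ 2 = (a : ℚ) * (a - 1) * (2 * a - 1) / 6 := by
    rw [Finset.sum_congr rfl (fun n hn => by rw [hW n (Finset.mem_range.1 hn)]),
      sum_class ha h (fun x => (x : ℚ) ^ 2)]
    clear * -
    induction a with
    | zero => simp
    | succ n ih => rw [Finset.sum_range_succ, ih]; push_cast; ring
  have hdouble : ∑ j ∈ Finset.range a, ∑ k ∈ Finset.range a, ((W j : ℚ) - W k) ^ 2 =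
      2 * (a * ∑ n ∈ Finset.range a, (W n : ℚ) ^ 2) - 2 * (∑ n ∈ Finset.range a, (W n : ℚ)) ^ 2 := by
    have : ∀ j, ∑ k ∈ Finset.range a, ((W j : ℚ) - W k) ^ 2 =
        a * (W j : ℚ) ^ 2 - 2 * (W j) * (∑ n ∈ Finset.range a, (W n : ℚ)) +
          ∑ n ∈ Finset.range a, (W n : ℚ) ^ 2 := by
      intro j
      have h1 : (a : ℚ) * (W j : ℚ) ^ 2 = ∑ k ∈ Finset.range a, (W j : ℚ) ^ 2 := by simp
      rw [Finset.mul_sum, h1, ← Finset.sum_sub_distrib, ← Finset.sum_add_distrib]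
      apply Finset.sum_congr rfl
      intro k _
      ring
    simp only [this]
    rw [Finset.sum_add_distrib, Finset.sum_sub_distrib, ← Finset.sum_mul, ← Finset.mul_sum, ← Finset.mul_sum]
    simp only [Finset.sum_const, Finset.card_range, nsmul_eq_mul]
    ring
  have hW1 : ∑ n ∈ Finset.range a, (W n : ℚ) =
      a * ∑ n ∈ Finset.range a, ((W n / a : ℕ) : ℚ) + ∑ n ∈ Finset.range a, ((W n % a : ℕ) : ℚ) := by
    rw [Finset.mul_sum, ← Finset.sum_add_distrib]
    exact Finset.sum_congr rfl (fun n _ => hWd n)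
  have hW2 : ∑ n ∈ Finset.range a, (W n : ℚ) ^ 2 =
      a ^ 2 * ∑ n ∈ Finset.range a, ((W n / a : ℕ) : ℚ) ^ 2 +
      2 * a * ∑ n ∈ Finset.range a, (((W n / a : ℕ) : ℚ) * ((W n % a : ℕ) : ℚ)) +
      ∑ n ∈ Finset.range a, ((W n % a : ℕ) : ℚ) ^ 2 := by
    rw [Finset.mul_sum, Finset.mul_sum, ← Finset.sum_add_distrib, ← Finset.sum_add_distrib]
    apply Finset.sum_congr rfl
    intro n _
    rw [hWd n]
    ring
  have hS : ∑ n ∈ Finset.range a,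
      (((W n / a : ℕ) : ℚ) * ((W n % a : ℕ) : ℚ) +
        a * (((W n / a : ℕ) : ℚ) * (((W n / a : ℕ) : ℚ) - 1) / 2)) =
      ∑ n ∈ Finset.range a, (((W n / a : ℕ) : ℚ) * ((W n % a : ℕ) : ℚ)) +
      a / 2 * (∑ n ∈ Finset.range a, ((W n / a : ℕ) : ℚ) ^ 2 - ∑ n ∈ Finset.range a, ((W n / a : ℕ) : ℚ)) := by
    rw [← Finset.sum_sub_distrib, Finset.mul_sum, ← Finset.sum_add_distrib]
    apply Finset.sum_congr rfl
    intro n _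
    ring
  rw [hdouble, hW2, hW1, hR1, hR2, hsum, hcard, hS]
  generalize ∑ n ∈ Finset.range a, ((W n / a : ℕ) : ℚ) ^ 2 = q2
  generalize ∑ n ∈ Finset.range a, ((W n / a : ℕ) : ℚ) = q1
  generalize ∑ n ∈ Finset.range a, (((W n / a : ℕ) : ℚ) * ((W n % a : ℕ) : ℚ)) = qr
  have ha' : (a : ℚ) ≠ 0 := by exact_mod_cast ha.ne'
  field_simp
  ring

section Bij
variable (a b : ℕ) [NeZero a]

def toB (a b : ℕ) (z : ZMod a → ℕ) : Finset ℕ := gapSet a (fun n => (walk a b z n).toNat)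

/-- Beta sets of simultaneous cores. -/
def Closed (t : ℕ) (B : Finset ℕ) : Prop := ∀ x ∈ B, t ≤ x → x - t ∈ B

lemma walk_toNat {z : ZMod a → ℕ} (hz : z ∈ Dyck a b) (n : ℕ) :
    (((walk a b z n).toNat : ℕ) : ℤ) = walk a b z n :=
  Int.toNat_of_nonneg (((mem_Dyck a b).1 hz).2 n)

lemma walk_toNat_mod {z : ZMod a → ℕ} (hz : z ∈ Dyck a b) (n : ℕ) :
    (walk a b z n).toNat % a = n * b % a := by
  have h1 := walk_toNat a b hz n
  have : (((walk a b z n).toNat : ℕ) : ℤ) ≡ ((n * b : ℕ) : ℤ) [ZMOD a] := by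
    rw [h1, Int.modEq_iff_dvd]
    unfold walk
    push_cast
    exact ⟨∑ k ∈ Finset.range n, (z (k : ZMod a) : ℤ), by ring⟩
  exact Int.natCast_modEq_iff.1 this

lemma toB_size (h : Nat.Coprime a b) {z : ZMod a → ℕ} (hz : z ∈ Dyck a b) :
    (∑ x ∈ toB a b z, (x : ℚ)) - ((toB a b z).card : ℚ) * (((toB a b z).card : ℚ) - 1) / 2 =
      energy a b z / (4 * (a : ℚ) ^ 2) - ((a : ℚ) ^ 2 - 1) / 24 := by
  unfold toB
  rw [size_gapSet (NeZero.pos a) h (fun n _ => walk_toNat_mod a b hz n)]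
  unfold energy
  have : ∀ n, (((walk a b z n).toNat : ℕ) : ℚ) = (walk a b z n : ℚ) := by
    intro n
    exact_mod_cast congrArg (fun x : ℤ => (x : ℚ)) (walk_toNat a b hz n)
  simp only [this]

lemma toB_closed (h : Nat.Coprime a b) {z : ZMod a → ℕ} (hz : z ∈ Dyck a b) :
    0 ∉ toB a b z ∧ Closed a (toB a b z) ∧ Closed b (toB a b z) := by
  have ha := NeZero.pos a
  have hm := fun n (_ : n < a) => walk_toNat_mod a b hz n
  have key : ∀ {x n}, n < a → n * b % a = x % a → (x ∈ toB a b z ↔ x < (walk a b z n).toNat) :=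
    fun hn hx => mem_gapSet_class ha h hm hn hx
  refine ⟨?_, ?_, ?_⟩
  · rw [key ha (by simp)]
    simp [walk_zero]
  · intro x hx hle
    obtain ⟨n, hn, hc⟩ := exists_class ha h x
    rw [key hn hc] at hx
    rw [key hn (by rw [hc, ← Nat.mod_eq_sub_mod hle])]
    omega
  · intro x hx hle
    obtain ⟨n, hn, hc⟩ := exists_class ha h x
    rw [key hn hc] at hx
    cases n with
    | zero => simp [walk_zero] at hx
    | succ n =>
      have hc' : n * b % a = (x - b) % a := by
        have : n * b + b ≡ (x - b) + b [MOD a] := by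
          rw [Nat.sub_add_cancel hle, Nat.ModEq, ← hc, Nat.succ_mul]
        exact Nat.ModEq.add_right_cancel' b this
      rw [key (by omega) hc']
      have h1 := walk_toNat a b hz n
      have h2 := walk_toNat a b hz (n + 1)
      have h3 := walk_succ a b z n
      have h4 : 0 ≤ (a : ℤ) * z (n : ZMod a) := by positivity
      omega

lemma toB_inj (h : Nat.Coprime a b) : Set.InjOn (toB a b) (Dyck a b) := by
  have ha := NeZero.pos a
  intro z hz z' hz' he
  rw [Finset.mem_coe] at hz hz'
  have key : ∀ {z}, z ∈ Dyck a b → ∀ {x n}, n < a → n * b % a = x % a →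
      (x ∈ toB a b z ↔ x < (walk a b z n).toNat) :=
    fun hz => fun hn hx => mem_gapSet_class ha h (fun n (_ : n < a) => walk_toNat_mod a b hz n) hn hx
  have hW : ∀ n < a, walk a b z n = walk a b z' n := by
    intro n hn
    have hall : ∀ x, n * b % a = x % a → (x < (walk a b z n).toNat ↔ x < (walk a b z' n).toNat) := by
      intro x hx
      rw [← key hz hn hx, ← key hz' hn hx, he]
    have h1 := hall _ (walk_toNat_mod a b hz n).symm
    have h2 := hall _ (walk_toNat_mod a b hz' n).symm
    rw [← walk_toNat a b hz, ← walk_toNat a b hz']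
    omega
  have hW' : ∀ n ≤ a, walk a b z n = walk a b z' n := by
    intro n hn
    rcases hn.lt_or_eq with hlt | rfl
    · exact hW n hlt
    · rw [walk_a n b ((mem_Dyck n b).1 hz).1, walk_a n b ((mem_Dyck n b).1 hz').1]
  funext i
  have hi := ZMod.val_lt i
  have e1 := hW' i.val hi.le
  have e2 := hW' (i.val + 1) hi
  rw [walk_succ, walk_succ, e1] at e2
  rw [ZMod.natCast_zmod_val] at e2
  have : (a : ℤ) * z i = a * z' i := by linarith
  have h3 := mul_left_cancel₀ (by exact_mod_cast ha.ne') this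
  exact_mod_cast h3

lemma toB_surj (h : Nat.Coprime a b) (B : Finset ℕ) (h0 : 0 ∉ B) (hBa : Closed a B) (hBb : Closed b B) :
    ∃ z ∈ Dyck a b, toB a b z = B := by
  have ha := NeZero.pos a
  have hit : ∀ q x, x ∈ B → a * q ≤ x → x - a * q ∈ B := by
    intro q
    induction q with
    | zero => intro x hx _; simpa using hx
    | succ q ih =>
      intro x hx hle
      rw [Nat.mul_succ] at hle ⊢
      rw [← Nat.sub_sub]
      exact hBa _ (ih x hx (by omega)) (by omega)
  have hex : ∀ c : ℕ, ∃ x, x ∉ B ∧ x % a = c % a := by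
    intro c
    refine ⟨c % a + a * (B.sup id + 1), ?_, by simp⟩
    intro hx
    have h1 : c % a + a * (B.sup id + 1) ≤ B.sup id := Finset.le_sup (f := id) hx
    have h2 : B.sup id + 1 ≤ a * (B.sup id + 1) := Nat.le_mul_of_pos_left _ ha
    omega
  have hex2 : ∀ c : ℕ, ∃ x, (x ∉ B ∧ x % a = c % a) ∧ ∀ y < x, ¬ (y ∉ B ∧ y % a = c % a) := by
    intro c
    classical
    exact ⟨Nat.find (hex c), Nat.find_spec (hex c), fun y hy => Nat.find_min (hex c) hy⟩
  choose V hV hVmin using hex2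
  have hVuniq : ∀ c x, x ∉ B → x % a = c % a → V c ≤ x := by
    intro c x hx hm
    by_contra hlt
    exact hVmin c x (by omega) ⟨hx, hm⟩
  have hV0 : ∀ c, c % a = 0 → V c = 0 := by
    intro c hc
    have := hVuniq c 0 h0 (by simp [hc])
    omega
  set W : ℕ → ℕ := fun n => V (n * b) with hWdef
  have hW0 : W 0 = 0 := hV0 _ (by simp)
  have hWa : W a = 0 := hV0 _ (by simp)
  have hstep : ∀ n, W (n + 1) ≤ W n + b := by
    intro n
    apply hVuniq
    · intro hmem
      have := hBb _ hmem (by omega)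
      rw [Nat.add_sub_cancel] at this
      exact (hV (n * b)).1 this
    · rw [Nat.succ_mul, Nat.add_mod, (hV (n * b)).2, ← Nat.add_mod]
  have hdvd : ∀ n, a ∣ W n + b - W (n + 1) := by
    intro n
    have : W (n + 1) ≡ W n + b [MOD a] := by
      rw [Nat.ModEq]
      simp only [hWdef]
      rw [(hV _).2, Nat.succ_mul, Nat.add_mod (V (n * b)), (hV (n * b)).2, ← Nat.add_mod]
    exact (Nat.modEq_iff_dvd' (hstep n)).1 this
  let z : ZMod a → ℕ := fun i => (W i.val + b - W (i.val + 1)) / a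
  have hz : ∀ n < a, a * z (n : ZMod a) = W n + b - W (n + 1) := by
    intro n hn
    simp only [z]
    rw [ZMod.val_cast_of_lt hn]
    exact Nat.mul_div_cancel' (hdvd n)
  have hwalk : ∀ n ≤ a, walk a b z n = W n := by
    intro n
    induction n with
    | zero => intro _; simp [walk_zero, hW0]
    | succ n ih =>
      intro hn
      rw [walk_succ, ih (by omega)]
      have h1 := hz n (by omega)
      have h2 := hstep n
      have h3 : ((a * z (n : ZMod a) : ℕ) : ℤ) = a * z (n : ZMod a) := by push_cast; ring
      rw [← h3, h1]
      omega
  have hcomp : z ∈ Comp (ZMod a) b := by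
    rw [mem_Comp]
    have h1 := hwalk a le_rfl
    rw [hWa] at h1
    unfold walk at h1
    rw [sum_range_zmod a (fun i => (z i : ℤ))] at h1
    have h2 : (a : ℤ) * (∑ i, (z i : ℤ)) = a * b := by push_cast at h1; linarith
    have h3 := mul_left_cancel₀ (by exact_mod_cast ha.ne') h2
    exact_mod_cast h3
  have hD : z ∈ Dyck a b := by
    rw [mem_Dyck]
    refine ⟨hcomp, fun n => ?_⟩
    rw [← walk_mod a b hcomp, hwalk _ (Nat.mod_lt _ ha).le]
    positivity
  refine ⟨z, hD, ?_⟩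
  ext x
  obtain ⟨n, hn, hc⟩ := exists_class ha h x
  have e1 : x ∈ toB a b z ↔ x < (walk a b z n).toNat :=
    mem_gapSet_class ha h (fun n (_ : n < a) => walk_toNat_mod a b hD n) hn hc
  rw [e1, hwalk n hn.le, Int.toNat_natCast]
  constructor
  · intro hlt
    by_contra hx
    have := hVuniq (n * b) x hx hc.symm
    simp only [hWdef] at hlt
    omega
  · intro hx
    by_contra hlt
    have hm : W n ≡ x [MOD a] := by
      rw [Nat.ModEq, ← hc]
      exact (hV (n * b)).2
    obtain ⟨q, hq⟩ := (Nat.modEq_iff_dvd' (by omega)).1 hm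
    have := hit q x hx (by omega)
    rw [← hq, Nat.sub_sub_self (by omega)] at this
    exact (hV (n * b)).1 this

end Bij

theorem armstrong_conjecture (t1 t2 : ℕ) (h1 : 0 < t1) (h2 : 0 < t2)
    (h : Nat.Coprime t1 t2) :
    ∃ hf : {Y : YoungDiagram | IsCore Y t1 ∧ IsCore Y t2}.Finite,
      (∑ Y ∈ hf.toFinset, (Y.card : ℚ)) /
          (({Y : YoungDiagram | IsCore Y t1 ∧ IsCore Y t2}.ncard : ℚ)) =
        ((t1 : ℚ) - 1) * ((t2 : ℚ) - 1) * ((t1 : ℚ) + t2 + 1) / 24 := by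

  haveI : NeZero t1 := ⟨h1.ne'⟩
  classical
  have hset : {Y : YoungDiagram | IsCore Y t1 ∧ IsCore Y t2} =
      betaSet ⁻¹' (((Dyck t1 t2).image (toB t1 t2) : Finset (Finset ℕ)) : Set (Finset ℕ)) := by
    ext Y
    simp only [Set.mem_setOf_eq, Set.mem_preimage, Finset.mem_coe, Finset.mem_image]
    rw [core_iff Y t1 h1, core_iff Y t2 h2]
    constructor
    · rintro ⟨c1, c2⟩
      exact toB_surj t1 t2 h _ (beta_zero Y) c1 c2
    · rintro ⟨z, hz, he⟩
      have := toB_closed t1 t2 h hz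
      rw [he] at this
      exact this.2
  have hinj : Function.Injective betaSet := fun Y Y' he => beta_inj he
  have hf : {Y : YoungDiagram | IsCore Y t1 ∧ IsCore Y t2}.Finite := by
    rw [hset]
    exact (Finset.finite_toSet _).preimage hinj.injOn
  refine ⟨hf, ?_⟩
  have himg : hf.toFinset.image betaSet = (Dyck t1 t2).image (toB t1 t2) := by
    ext B
    simp only [Finset.mem_image (s := hf.toFinset), Set.Finite.mem_toFinset]
    rw [hset]
    constructor
    · rintro ⟨Y, hY, rfl⟩
      exact hY
    · intro hB
      obtain ⟨z, hz, rfl⟩ := Finset.mem_image.1 hB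
      obtain ⟨Y, hY⟩ := beta_surj _ (toB_closed t1 t2 h hz).1
      refine ⟨Y, ?_, hY⟩
      rw [Set.mem_preimage, hY]
      exact hB
  have hcard : {Y : YoungDiagram | IsCore Y t1 ∧ IsCore Y t2}.ncard = (Dyck t1 t2).card := by
    rw [Set.ncard_eq_toFinset_card _ hf, ← Finset.card_image_of_injective _ hinj, himg,
      Finset.card_image_of_injOn (toB_inj t1 t2 h)]
  have hsum : ∑ Y ∈ hf.toFinset, (Y.card : ℚ) =
      ∑ z ∈ Dyck t1 t2, (energy t1 t2 z / (4 * (t1 : ℚ) ^ 2) - ((t1 : ℚ) ^ 2 - 1) / 24) := by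
    rw [Finset.sum_congr rfl (fun Y _ => size_beta Y)]
    rw [← Finset.sum_image (f := fun B : Finset ℕ => (∑ x ∈ B, (x : ℚ)) - (B.card : ℚ) * ((B.card : ℚ) - 1) / 2)
      hinj.injOn, himg, Finset.sum_image (toB_inj t1 t2 h)]
    exact Finset.sum_congr rfl (fun z hz => toB_size t1 t2 h hz)
  have c1 := cycle_lemma t1 t2 h (fun _ => 1) (fun _ _ _ => rfl)
  have c2 := cycle_lemma t1 t2 h (energy t1 t2) (fun z hz r => energy_rot t1 t2 hz r)
  rw [sum_energy] at c2
  simp only [Finset.sum_const, nsmul_eq_mul, mul_one] at c1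
  have hN : (0 : ℚ) < ((Comp (ZMod t1) t2).card : ℚ) := by
    have : (Pi.single 0 t2 : ZMod t1 → ℕ) ∈ Comp (ZMod t1) t2 := by
      rw [mem_Comp]
      simp
    exact_mod_cast Finset.card_pos.2 ⟨_, this⟩
  rw [hsum, hcard, Finset.sum_sub_distrib, ← Finset.sum_div]
  simp only [Finset.sum_const, nsmul_eq_mul]
  have ht : (0 : ℚ) < t1 := by exact_mod_cast h1
  rw [c1] at c2 hN
  have hM : (0 : ℚ) < ((Dyck t1 t2).card : ℚ) := by
    by_contra hc
    nlinarith
  have hE : ∑ z ∈ Dyck t1 t2, energy t1 t2 z = ((Dyck t1 t2).card : ℚ) *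
      ((t1 : ℚ) ^ 2 * ((t1 : ℚ) ^ 2 - 1) / 6) * (t2 * ((t1 : ℚ) + t2) / ((t1 : ℚ) + 1)) := by
    apply mul_left_cancel₀ ht.ne'
    rw [← c2]
    ring
  rw [hE]
  field_simp
  ring
end

section
/- Let t1 and t2 be coprime positive integers. The largest size of a partition that is simultaneously t1-core and t2-core equals (t1^2-1)(t2^2-1)/24. -/
open Finset in
lemma os_card (Y : YoungDiagram) (N : ℕ) (hN : Y.colLen 0 ≤ N) :
    Y.card = ∑ i ∈ range N, Y.rowLen i := by
  have h : ∀ c ∈ Y.cells, c.1 ∈ range N := by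
    intro c hc
    have h1 : (c.1, 0) ∈ Y := Y.up_left_mem le_rfl (Nat.zero_le _) ((YoungDiagram.mem_cells c).1 hc)
    have := YoungDiagram.mem_iff_lt_colLen.1 h1
    simp; omega
  rw [YoungDiagram.card, card_eq_sum_card_fiberwise h]
  refine sum_congr rfl fun i _ => ?_
  rw [YoungDiagram.rowLen_eq_card]
  rfl

lemma os_rc (Y : YoungDiagram) (i j : ℕ) : j < Y.rowLen i ↔ i < Y.colLen j := by
  rw [← YoungDiagram.mem_iff_lt_rowLen, ← YoungDiagram.mem_iff_lt_colLen]

def osf (Y : YoungDiagram) (N i : ℕ) : ℕ := Y.rowLen i + (N - 1 - i)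

lemma osf_lt (Y : YoungDiagram) (N i j : ℕ) (hij : i < j) (hj : j < N) :
    osf Y N j < osf Y N i := by
  have := Y.rowLen_anti i j hij.le
  unfold osf; omega

open Finset in
def osB (Y : YoungDiagram) (N : ℕ) : Finset ℕ := (range N).image (osf Y N)

lemma osf_inj (Y : YoungDiagram) (N : ℕ) : Set.InjOn (osf Y N) (Finset.range N) := by
  intro a ha b hb hab
  simp at ha hb
  rcases lt_trichotomy a b with h | h | h
  · have := osf_lt Y N a b h hb; omega
  · exact h
  · have := osf_lt Y N b a h ha; omega

/-- closure of the beta set of a core -/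
lemma os_closed (Y : YoungDiagram) (N t : ℕ) (hN : Y.colLen 0 ≤ N) (ht : 0 < t)
    (hY : IsCore Y t) (x : ℕ) (hx : x + t ∈ osB Y N) : x ∈ osB Y N := by
  by_contra hxn
  simp only [osB, Finset.mem_image, Finset.mem_range, not_exists, not_and] at hx hxn
  obtain ⟨i, hi, hix⟩ := hx
  have hex : ∃ k, N ≤ k ∨ osf Y N k < x := ⟨N, Or.inl le_rfl⟩
  classical
  obtain ⟨k, hk, hmin⟩ : ∃ k, (N ≤ k ∨ osf Y N k < x) ∧ ∀ l < k, ¬ (N ≤ l ∨ osf Y N l < x) :=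
    ⟨Nat.find hex, Nat.find_spec hex, fun l hl => Nat.find_min hex hl⟩
  have hik : i < k := by
    by_contra hc
    rcases hk with hk | hk
    · omega
    · rcases Nat.lt_or_ge k i with h | h
      · have := osf_lt Y N k i h hi; omega
      · have : k = i := by omega
        subst this; omega
  have h1 := hmin (k-1) (by omega)
  have h2 : osf Y N (k-1) ≠ x := hxn (k-1) (by omega)
  push Not at h1
  have hkN : k ≤ N := by omega
  have hr : Y.rowLen k + N ≤ x + k := by
    rcases hk with hk | hk
    · have h0 : ¬ (0 < Y.rowLen k) := by rw [os_rc]; omega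
      omega
    · unfold osf at hk; omega
  obtain ⟨j, hj⟩ : ∃ j, x + k = N + j := ⟨x + k - N, by omega⟩
  have h3 : j < Y.rowLen (k-1) := by
    have := h1.2
    unfold osf at this h2; omega
  have h4 : ¬ (j < Y.rowLen k) := by omega
  have h5 := Y.rowLen_anti i (k-1) (by omega)
  rw [os_rc] at h3 h4
  have h6 : j < Y.rowLen i := by rw [os_rc]; omega
  apply hY (i, j) (by rw [YoungDiagram.mem_cells, YoungDiagram.mem_iff_lt_rowLen]; exact h6)
  have : hook Y i j = t := by
    unfold hook
    unfold osf at hix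
    omega
  simp [this]

lemma os_closed_mul (B : Finset ℕ) (t : ℕ) (h : ∀ x, x + t ∈ B → x ∈ B) (q x : ℕ)
    (hx : x + t * q ∈ B) : x ∈ B := by
  induction q with
  | zero => simpa using hx
  | succ q ih =>
    apply ih; apply h
    convert hx using 1
    ring

lemma os_core_of_closed (Y : YoungDiagram) (N t : ℕ) (hN : Y.colLen 0 ≤ N)
    (h : ∀ x, x + t ∈ osB Y N → x ∈ osB Y N) : IsCore Y t := by
  rintro ⟨i, j⟩ hc ⟨q, hq⟩
  simp only at hq
  rw [YoungDiagram.mem_cells, YoungDiagram.mem_iff_lt_rowLen] at hc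
  have hc' := (os_rc Y i j).1 hc
  have hj := Y.colLen_anti 0 j (Nat.zero_le _)
  have hiN : i < N := by omega
  have hm : N + j - Y.colLen j ∈ osB Y N := by
    apply os_closed_mul _ t h q
    rw [← hq]
    refine Finset.mem_image.2 ⟨i, by simpa using hiN, ?_⟩
    unfold osf hook; omega
  simp only [osB, Finset.mem_image, Finset.mem_range] at hm
  obtain ⟨k, hk, hkx⟩ := hm
  have := os_rc Y k j
  unfold osf at hkx
  omega

open Finset in
lemma os_size (Y : YoungDiagram) (N : ℕ) (hN : Y.colLen 0 ≤ N) :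
    (osB Y N).card = N ∧ (2 * Y.card + N * (N - 1) : ℤ) = 2 * ∑ x ∈ osB Y N, (x : ℤ) := by
  refine ⟨by rw [osB, card_image_of_injOn (osf_inj Y N), card_range], ?_⟩
  rw [osB, sum_image (osf_inj Y N), os_card Y N hN]
  have e : ∀ M : ℕ, 2 * ∑ i ∈ range M, ((M - 1 - i : ℕ) : ℤ) = M * (M - 1) := by
    intro M
    rw [Finset.sum_range_reflect (fun i => (i : ℤ)) M]
    induction M with
    | zero => simp
    | succ n ih => rw [sum_range_succ, mul_add, ih]; push_cast; ring
  simp only [osf]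
  push_cast
  rw [sum_add_distrib, mul_add, ← e N]

/-- construct a diagram from a beta set -/
lemma os_exists (B : Finset ℕ) : ∃ Y : YoungDiagram, ∃ N, Y.colLen 0 ≤ N ∧ osB Y N = B := by
  classical
  set N := B.card with hNdef
  set g : ℕ → ℕ := Nat.nth (· ∈ B) with hg
  have hfin : {x | x ∈ B}.Finite := B.finite_toSet
  have hcard : hfin.toFinset.card = N := by
    rw [hNdef]; congr 1; ext; simp
  have hlt : ∀ a b, a < b → b < N → g a < g b := fun a b hab hb =>
    Nat.nth_lt_nth_of_lt_card hfin hab (by rw [hcard]; exact hb)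
  have hshift : ∀ d a, a + d < N → g a + d ≤ g (a + d) := by
    intro d
    induction d with
    | zero => simp
    | succ d ih =>
      intro a ha
      have h1 := ih a (by omega)
      have h2 := hlt (a + d) (a + (d+1)) (by omega) ha
      omega
  have hge : ∀ k < N, k ≤ g k := by
    intro k hk
    have := hshift k 0 (by omega)
    simp at this; omega
  have hmem : ∀ k < N, g k ∈ B := fun k hk => Nat.nth_mem_of_lt_card hfin (by rw [hcard]; exact hk)
  let M := B.sup id + 1
  have hM : ∀ x ∈ B, x < M := fun x hx => Nat.lt_succ_of_le (Finset.le_sup (f := id) hx)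
  let Y : YoungDiagram := 
    { cells := (Finset.range N ×ˢ Finset.range M).filter
        (fun c => c.2 + (N - 1 - c.1) < g (N - 1 - c.1))
      isLowerSet := by
        rintro ⟨a, b⟩ ⟨c, d⟩ hle hab
        obtain ⟨h1, h2⟩ := Prod.mk_le_mk.1 hle
        simp only [Finset.coe_filter, Finset.mem_product, Finset.mem_range, Set.mem_ofPred_eq] at hab ⊢
        have := hshift (a - c) (N - 1 - a) (by omega)
        have e : N - 1 - a + (a - c) = N - 1 - c := by omega
        rw [e] at this
        omega }
  have hY : ∀ i j, (i, j) ∈ Y ↔ i < N ∧ j + (N - 1 - i) < g (N - 1 - i) := by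
    intro i j
    rw [← YoungDiagram.mem_cells]
    simp only [Y, Finset.mem_filter, Finset.mem_product, Finset.mem_range]
    constructor
    · rintro ⟨⟨h1, h2⟩, h3⟩; exact ⟨h1, h3⟩
    · rintro ⟨h1, h3⟩
      have := hM _ (hmem (N - 1 - i) (by omega))
      exact ⟨⟨h1, by omega⟩, h3⟩
  have hrow : ∀ i < N, osf Y N i = g (N - 1 - i) := by
    intro i hi
    have h1 := hge (N - 1 - i) (by omega)
    have h2 : ∀ j, j < Y.rowLen i ↔ j + (N - 1 - i) < g (N - 1 - i) := by
      intro j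
      rw [← YoungDiagram.mem_iff_lt_rowLen, hY]; simp [hi]
    unfold osf
    have h3 := h2 (Y.rowLen i)
    have h4 := h2 (g (N - 1 - i) - (N - 1 - i))
    omega
  refine ⟨Y, N, ?_, ?_⟩
  · by_contra hc
    push Not at hc
    have := YoungDiagram.mem_iff_lt_colLen.2 hc
    rw [hY] at this
    omega
  · apply Finset.eq_of_subset_of_card_le
    · intro x hx
      obtain ⟨i, hi, rfl⟩ := Finset.mem_image.1 hx
      rw [Finset.mem_range] at hi
      rw [hrow i hi]
      exact hmem _ (by omega)
    · rw [osB, Finset.card_image_of_injOn (osf_inj Y N), Finset.card_range]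

open Finset in
lemma os_sum_range (s : ℕ) : 2 * ∑ i ∈ range s, (i : ℤ) = s * (s - 1) := by
  induction s with
  | zero => simp
  | succ n ih => rw [sum_range_succ, mul_add, ih]; push_cast; ring

open Finset in
lemma os_sum_sq (s : ℕ) : 6 * ∑ i ∈ range s, (i : ℤ) ^ 2 = s * (s - 1) * (2 * s - 1) := by
  induction s with
  | zero => simp
  | succ n ih => rw [sum_range_succ, mul_add, ih]; push_cast; ring

/-- The sums over a beta set closed under subtraction of `s`. -/
lemma os_fiber (B : Finset ℕ) (s : ℕ) (hs : 0 < s) (a : ℕ → ℕ)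
    (hinj : Set.InjOn (fun k => a k % s) (Finset.range s))
    (hB : ∀ x, x ∈ B ↔ ∃ k < s, x % s = a k % s ∧ x < a k) (F : ℕ → ℤ) :
    ∑ x ∈ B, F x = ∑ k ∈ Finset.range s, ∑ q ∈ Finset.range (a k / s), F (a k % s + s * q) := by
  rw [Finset.sum_sigma']
  symm
  refine Finset.sum_bij (fun p _ => a p.1 % s + s * p.2) ?_ ?_ ?_ ?_
  · rintro ⟨k, q⟩ h
    simp only [Finset.mem_sigma, Finset.mem_range] at h
    rw [hB]
    refine ⟨k, h.1, by simp, ?_⟩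
    have := Nat.mod_add_div (a k) s
    have h2 : s * q < s * (a k / s) := Nat.mul_lt_mul_of_pos_left h.2 hs
    simp only; omega
  · rintro ⟨k, q⟩ h ⟨k', q'⟩ h' e
    simp only [Finset.mem_sigma, Finset.mem_range] at h h' e
    have e1 := congrArg (· % s) e
    simp only [Nat.add_mul_mod_self_left, Nat.mod_mod] at e1
    have : k = k' := hinj (by simpa using h.1) (by simpa using h'.1) e1
    subst this
    have : q = q' := Nat.eq_of_mul_eq_mul_left hs (by omega)
    subst this; rfl
  · intro x hx
    obtain ⟨k, hk, h1, h2⟩ := (hB x).1 hx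
    have h3 := Nat.mod_add_div (a k) s
    have h4 := Nat.mod_add_div x s
    refine ⟨⟨k, x / s⟩, ?_, ?_⟩
    · simp only [Finset.mem_sigma, Finset.mem_range]
      refine ⟨hk, ?_⟩
      by_contra hc
      push Not at hc
      have := Nat.mul_le_mul_left s hc
      omega
    · simp only; omega
  · intros; rfl

open Finset in
lemma os_formula (Y : YoungDiagram) (N : ℕ) (hN : Y.colLen 0 ≤ N) (s : ℕ) (hs : 0 < s) (a : ℕ → ℕ)
    (hinj : Set.InjOn (fun k => a k % s) (Finset.range s))
    (hB : ∀ x, x ∈ osB Y N ↔ ∃ k < s, x % s = a k % s ∧ x < a k) :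
    (24 * s ^ 2 * Y.card : ℤ) = 12 * (s * ∑ k ∈ range s, (a k : ℤ) ^ 2 - (∑ k ∈ range s, (a k : ℤ)) ^ 2)
      - s ^ 2 * (s ^ 2 - 1) := by
  obtain ⟨hc, hsz⟩ := os_size Y N hN
  have himg : (range s).image (fun k => a k % s) = range s := by
    apply eq_of_subset_of_card_le
    · intro x hx
      obtain ⟨k, _, rfl⟩ := mem_image.1 hx
      exact mem_range.2 (Nat.mod_lt _ hs)
    · rw [card_image_of_injOn hinj]
  have hmod : ∀ F : ℕ → ℤ, ∑ k ∈ range s, F (a k % s) = ∑ i ∈ range s, F i := by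
    intro F
    conv_rhs => rw [← himg]
    rw [sum_image hinj]
  have hd : ∀ k, ((a k : ℕ) : ℤ) = ((a k % s : ℕ) : ℤ) + s * ((a k / s : ℕ) : ℤ) := by
    intro k
    exact_mod_cast (Nat.mod_add_div (a k) s).symm
  have F1 := os_fiber (osB Y N) s hs a hinj hB (fun _ => 1)
  have F2 := os_fiber (osB Y N) s hs a hinj hB (fun x => (x : ℤ))
  have G1 : (s : ℤ) * N = ∑ k ∈ range s, (a k : ℤ) - ∑ i ∈ range s, (i : ℤ) := by
    rw [← hmod (fun i => (i : ℤ)), ← sum_sub_distrib]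
    simp only [sum_const, nsmul_eq_mul, mul_one, hc, card_range] at F1
    rw [F1, mul_sum]
    refine sum_congr rfl fun k _ => ?_
    rw [hd k]; ring
  have G2 : 2 * (s : ℤ) * ∑ x ∈ osB Y N, (x : ℤ) = (∑ k ∈ range s, (a k : ℤ) ^ 2 - ∑ i ∈ range s, (i : ℤ) ^ 2)
      - s * (∑ k ∈ range s, (a k : ℤ) - ∑ i ∈ range s, (i : ℤ)) := by
    rw [← hmod (fun i => (i : ℤ)), ← hmod (fun i => (i : ℤ) ^ 2), ← sum_sub_distrib, ← sum_sub_distrib,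
      mul_sum (s := range s), ← sum_sub_distrib, F2, mul_sum]
    refine sum_congr rfl fun k _ => ?_
    push_cast
    rw [sum_add_distrib, ← mul_sum]
    have := os_sum_range (a k / s)
    simp only [sum_const, nsmul_eq_mul, card_range]
    have h := hd k
    push_cast at h this ⊢
    set A := (a k : ℤ)
    set r := A % s
    set n := A / s
    rw [h]
    linear_combination (s : ℤ) ^ 2 * this
  have S1 := os_sum_range s
  have S2 := os_sum_sq s
  set A := ∑ k ∈ range s, (a k : ℤ)
  set Q := ∑ k ∈ range s, (a k : ℤ) ^ 2
  set I := ∑ i ∈ range s, (i : ℤ)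
  set J := ∑ i ∈ range s, (i : ℤ) ^ 2
  set T := ∑ x ∈ osB Y N, (x : ℤ)
  have hA : A = s * N + I := by linarith
  have hQ : Q = 2 * s * T + J + s * (A - I) := by linarith
  have hT : (2 * T : ℤ) = 2 * Y.card + N * (N - 1) := hsz.symm
  rw [hQ, hA]
  linear_combination (-12 * (s:ℤ)^2) * hT + (-2 * (s:ℤ)) * S2 + (12 * (s : ℤ) * N + 3 * (2 * I + s * (s-1))) * S1

open Finset in
lemma os_periodic_sum (s : ℕ) (x : ℕ → ℤ) (hper : ∀ k, x (k + s) = x k) (F : ℤ → ℤ) (m : ℕ) :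
    ∑ k ∈ range s, F (x (k + m)) = ∑ k ∈ range s, F (x k) := by
  induction m with
  | zero => simp
  | succ m ih =>
    rw [← ih]
    have h1 := sum_range_succ (fun k => F (x (k + m))) s
    have h2 := sum_range_succ' (fun k => F (x (k + m))) s
    have h3 : x (s + m) = x (0 + m) := by rw [add_comm s m, hper, zero_add]
    simp only [h3] at h1
    rw [h1] at h2
    have h4 := add_right_cancel h2
    rw [h4]
    refine sum_congr rfl fun k _ => ?_
    congr 2; ring

open Finset in
lemma os_ineq (s : ℕ) (t : ℤ) (x : ℕ → ℤ) (hper : ∀ k, x (k + s) = x k)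
    (hst : ∀ k, x (k + 1) ≤ x k + t) :
    12 * (s * ∑ k ∈ range s, x k ^ 2 - (∑ k ∈ range s, x k) ^ 2) ≤ t ^ 2 * (s ^ 2 * (s ^ 2 - 1)) := by
  have hstep : ∀ m k, x (k + m) ≤ x k + m * t := by
    intro m k
    induction m with
    | zero => simp
    | succ m ih =>
      have := hst (k + m)
      push_cast
      rw [← add_assoc]
      linarith
  have hm : ∀ m ∈ range s, ∑ k ∈ range s, (x (k + m) - x k) ^ 2 ≤ s * (m * (s - m) * t ^ 2) := by
    intro m hm
    rw [mem_range] at hm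
    have hb : ∀ k ∈ range s, (x (k + m) - x k) ^ 2 ≤
        m * (s - m) * t ^ 2 + (x (k + m) - x k) * (m * t - (s - m) * t) := by
      intro k _
      have h1 := hstep m k
      have h2 := hstep (s - m) (k + m)
      rw [show k + m + (s - m) = k + s by omega, hper, Nat.cast_sub hm.le] at h2
      nlinarith [mul_nonneg (sub_nonneg.2 h1) (sub_nonneg.2 h2)]
    refine (sum_le_sum hb).trans (le_of_eq ?_)
    rw [sum_add_distrib, ← sum_mul (f := fun k => x (k + m) - x k), sum_sub_distrib, os_periodic_sum s x hper (fun y => y) m]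
    simp
  have h1 := sum_le_sum hm
  rw [sum_comm] at h1
  have h2 : ∀ k ∈ range s, ∑ m ∈ range s, (x (k + m) - x k) ^ 2 = ∑ m ∈ range s, (x m - x k) ^ 2 := by
    intro k _
    rw [← os_periodic_sum s x hper (fun y => (y - x k) ^ 2) k]
    simp only [add_comm]
  rw [sum_congr rfl h2] at h1
  have h3 : ∑ k ∈ range s, ∑ m ∈ range s, (x m - x k) ^ 2 =
      2 * (s * ∑ k ∈ range s, x k ^ 2 - (∑ k ∈ range s, x k) ^ 2) := by
    have : ∀ k ∈ range s, ∑ m ∈ range s, (x m - x k) ^ 2 =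
        ∑ m ∈ range s, x m ^ 2 - 2 * x k * ∑ m ∈ range s, x m + s * x k ^ 2 := by
      intro k _
      rw [mul_sum, ← sum_sub_distrib]
      have e : (s : ℤ) * x k ^ 2 = ∑ m ∈ range s, x k ^ 2 := by simp
      rw [e, ← sum_add_distrib]
      exact sum_congr rfl fun m _ => by ring
    rw [sum_congr rfl this, sum_add_distrib, sum_sub_distrib, ← sum_mul, ← mul_sum, ← mul_sum]
    simp
    ring
  rw [h3] at h1
  have h4 : 6 * ∑ m ∈ range s, (s : ℤ) * (m * (s - m) * t ^ 2) = t ^ 2 * (s ^ 2 * (s ^ 2 - 1)) := by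
    have e : ∑ m ∈ range s, (s : ℤ) * (m * (s - m) * t ^ 2) =
        s * t ^ 2 * (s * ∑ m ∈ range s, (m : ℤ) - ∑ m ∈ range s, (m : ℤ) ^ 2) := by
      rw [mul_sum, ← sum_sub_distrib, mul_sum]
      exact sum_congr rfl fun m _ => by ring
    rw [e]
    linear_combination (3 * (s : ℤ) ^ 2 * t ^ 2) * os_sum_range s - s * t ^ 2 * os_sum_sq s
  linarith

lemma os_mod_inj (s t : ℕ) (h : Nat.Coprime s t) :
    Set.InjOn (fun k => (k * t) % s) (Finset.range s) := by
  intro a ha b hb hab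
  simp only [Finset.coe_range, Set.mem_Iio] at ha hb
  have : a ≡ b [MOD s] := Nat.ModEq.cancel_right_of_coprime h hab
  exact Nat.ModEq.eq_of_lt_of_lt this ha hb

theorem os_upper (s t : ℕ) (h1 : 0 < s) (h2 : 0 < t) (h : Nat.Coprime s t) (Y : YoungDiagram)
    (hs : IsCore Y s) (ht : IsCore Y t) :
    (24 * Y.card : ℤ) ≤ ((s : ℤ) ^ 2 - 1) * ((t : ℤ) ^ 2 - 1) := by
  classical
  set N := Y.colLen 0
  set B := osB Y N with hBdef
  have hex : ∀ k, ∃ x, x % s = (k * t) % s ∧ x ∉ B := by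
    intro k
    refine ⟨k * t + s * (B.sup id + 1), by simp, fun hm => ?_⟩
    have := Finset.le_sup (f := id) hm
    simp only [id] at this
    nlinarith [Nat.zero_le (k * t)]
  let a : ℕ → ℕ := fun k => Nat.find (hex k)
  have ha1 : ∀ k, a k % s = (k * t) % s := fun k => (Nat.find_spec (hex k)).1
  have ha2 : ∀ k, a k ∉ B := fun k => (Nat.find_spec (hex k)).2
  have ha3 : ∀ k x, x % s = (k * t) % s → x ∉ B → a k ≤ x := fun k x e hx =>
    Nat.find_min' (hex k) ⟨e, hx⟩
  have hinj := os_mod_inj s t h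
  have himg : (Finset.range s).image (fun k => (k * t) % s) = Finset.range s := by
    apply Finset.eq_of_subset_of_card_le
    · intro x hx
      obtain ⟨k, _, rfl⟩ := Finset.mem_image.1 hx
      exact Finset.mem_range.2 (Nat.mod_lt _ h1)
    · rw [Finset.card_image_of_injOn hinj]
  have key := os_formula Y N le_rfl s h1 a (by simpa only [ha1] using hinj) (by
    intro x
    constructor
    · intro hx
      have : x % s ∈ (Finset.range s).image (fun k => (k * t) % s) := by
        rw [himg]; exact Finset.mem_range.2 (Nat.mod_lt _ h1)
      obtain ⟨k, hk, e⟩ := Finset.mem_image.1 this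
      refine ⟨k, Finset.mem_range.1 hk, by rw [ha1, e], ?_⟩
      by_contra hc
      push Not at hc
      have hmod : a k ≡ x [MOD s] := by rw [Nat.ModEq, ha1, e]
      obtain ⟨q, hq⟩ := (Nat.modEq_iff_dvd' hc).1 hmod
      have hxe : x = a k + s * q := by omega
      rw [hxe] at hx
      exact ha2 k (os_closed_mul B s (fun y hy => os_closed Y N s le_rfl h1 hs y hy) q _ hx)
    · rintro ⟨k, _, e, hlt⟩
      by_contra hx
      have := ha3 k x (by rw [e, ha1]) hx
      omega)
  have hI := os_ineq s t (fun k => (a k : ℤ)) (by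
    intro k
    have hk : (k + s) * t % s = k * t % s := by
      rw [add_mul, Nat.add_mul_mod_self_left]
    have : a (k + s) = a k := le_antisymm (ha3 _ _ (by rw [ha1, hk]) (ha2 _))
      (ha3 _ _ (by rw [ha1, hk]) (ha2 _))
    simp only [this]) (by
    intro k
    have : a (k + 1) ≤ a k + t := by
      apply ha3
      · rw [Nat.add_mod, ha1, ← Nat.add_mod]; congr 1; ring
      · intro hm
        exact ha2 k (os_closed Y N t le_rfl h2 ht _ hm)
    exact_mod_cast this)
  have hpos : (0 : ℤ) < (s : ℤ) ^ 2 := by positivity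
  refine le_of_mul_le_mul_left ?_ hpos
  linarith

theorem os_lower (s t : ℕ) (h1 : 0 < s) (h : Nat.Coprime s t) :
    ∃ Y : YoungDiagram, IsCore Y s ∧ IsCore Y t ∧
    (24 * Y.card : ℤ) = ((s : ℤ) ^ 2 - 1) * ((t : ℤ) ^ 2 - 1) := by
  classical
  set B : Finset ℕ := (Finset.range (s * t)).filter (fun x => ∃ k < s, x % s = (k * t) % s ∧ x < k * t)
    with hBdef
  have hB : ∀ x, x ∈ B ↔ ∃ k < s, x % s = (k * t) % s ∧ x < k * t := by
    intro x
    simp only [hBdef, Finset.mem_filter, Finset.mem_range, and_iff_right_iff_imp]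
    rintro ⟨k, hk, _, hx⟩
    exact hx.trans_le (Nat.mul_le_mul_right t hk.le)
  obtain ⟨Y, N, hN, hY⟩ := os_exists B
  refine ⟨Y, ?_, ?_, ?_⟩
  · apply os_core_of_closed Y N s hN
    rw [hY]
    intro x hx
    rw [hB] at hx ⊢
    obtain ⟨k, hk, e, hlt⟩ := hx
    exact ⟨k, hk, by simpa using e, by omega⟩
  · apply os_core_of_closed Y N t hN
    rw [hY]
    intro x hx
    rw [hB] at hx ⊢
    obtain ⟨k, hk, e, hlt⟩ := hx
    obtain ⟨k, rfl⟩ : ∃ l, k = l + 1 := ⟨k - 1, by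
      rcases k with _ | k
      · simp at hlt
      · simp⟩
    rw [add_mul, one_mul] at e hlt
    exact ⟨k, by omega, Nat.ModEq.add_right_cancel' t e, by omega⟩
  · have key := os_formula Y N hN s h1 (fun k => k * t) (os_mod_inj s t h) (by rw [hY]; exact hB)
    have hpos : (0 : ℤ) < (s : ℤ) ^ 2 := by positivity
    refine mul_left_cancel₀ hpos.ne' ?_
    push_cast at key
    simp only [mul_pow, ← Finset.sum_mul] at key
    have S1 := os_sum_range s
    have S2 := os_sum_sq s
    set I := ∑ i ∈ Finset.range s, (i : ℤ)
    set J := ∑ i ∈ Finset.range s, (i : ℤ) ^ 2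
    linear_combination key + (2 * (s:ℤ) * t ^ 2) * S2 - (3 * (t:ℤ) ^ 2 * (2 * I + s * (s - 1))) * S1

theorem olsson_stanton (t1 t2 : ℕ) (h1 : 0 < t1) (h2 : 0 < t2)
    (h : Nat.Coprime t1 t2) :
    IsGreatest {m : ℕ | ∃ Y : YoungDiagram, IsCore Y t1 ∧ IsCore Y t2 ∧ Y.card = m}
      ((t1 ^ 2 - 1) * (t2 ^ 2 - 1) / 24) := by
  have c1 : ((t1 ^ 2 - 1 : ℕ) : ℤ) = (t1 : ℤ) ^ 2 - 1 := by
    rw [Nat.cast_sub (Nat.one_le_pow _ _ h1)]; push_cast; rfl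
  have c2 : ((t2 ^ 2 - 1 : ℕ) : ℤ) = (t2 : ℤ) ^ 2 - 1 := by
    rw [Nat.cast_sub (Nat.one_le_pow _ _ h2)]; push_cast; rfl
  constructor
  · obtain ⟨Y, hs, ht, hY⟩ := os_lower t1 t2 h1 h
    refine ⟨Y, hs, ht, ?_⟩
    have : 24 * Y.card = (t1 ^ 2 - 1) * (t2 ^ 2 - 1) := by
      zify; rw [c1, c2]; exact hY
    omega
  · rintro m ⟨Y, hs, ht, rfl⟩
    have hY := os_upper t1 t2 h1 h2 h Y hs ht
    have : 24 * Y.card ≤ (t1 ^ 2 - 1) * (t2 ^ 2 - 1) := by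
      zify; rw [c1, c2]; exact hY
    omega
end

section
/- Let G(d,m,a,b)(n) = Σ_{I nice ⊆ A(d,n)} σ_m(I)^a |I|^b, where σ_m(I) = Σ_{(i,j)∈I} ((i-1)m + j). Then for fixed m, n ≥ 1 and a, b ≥ 0 with a+b ≥ 1, G(d,m,a,b)(n) is a polynomial in d of degree 2a + b + ⌊(n+1)/2⌋. -/
def gridA (d n : ℕ) : Finset (ℕ × ℕ) := Finset.Icc 1 d ×ˢ Finset.Icc 1 n

def Nice (d n : ℕ) (I : Finset (ℕ × ℕ)) : Prop :=
  I ⊆ gridA d n ∧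
  (∀ i j : ℕ, 1 ≤ i → (i + 1, j) ∈ I → (i, j) ∈ I) ∧
  (∀ j : ℕ, 1 ≤ j → j ≤ n - 1 → (1, j) ∈ I → (1, j + 1) ∉ I)

noncomputable def Gcount (d n : ℕ) : ℕ := {I : Finset (ℕ × ℕ) | Nice d n I}.ncard
def sigmaW (m : ℕ) (I : Finset (ℕ × ℕ)) : ℕ := ∑ p ∈ I, ((p.1 - 1) * m + p.2)

open Finset in
noncomputable def niceF (d n : ℕ) : Finset (Finset (ℕ × ℕ)) := by
  classical exact (gridA d n).powerset.filter (Nice d n)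

theorem mem_niceF {d n : ℕ} {I : Finset (ℕ × ℕ)} : I ∈ niceF d n ↔ Nice d n I := by
  classical
  simp only [niceF, Finset.mem_filter, Finset.mem_powerset]
  exact ⟨fun h => h.2, fun h => ⟨h.1, h⟩⟩

def colF (h j : ℕ) : Finset (ℕ × ℕ) := Finset.Icc 1 h ×ˢ {j}

theorem mem_colF {h j : ℕ} {p : ℕ × ℕ} : p ∈ colF h j ↔ (1 ≤ p.1 ∧ p.1 ≤ h) ∧ p.2 = j := by
  obtain ⟨i, k⟩ := p
  rw [colF, Finset.mem_product, Finset.mem_Icc, Finset.mem_singleton]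

theorem mem_gridA {d n : ℕ} {p : ℕ × ℕ} :
    p ∈ gridA d n ↔ (1 ≤ p.1 ∧ p.1 ≤ d) ∧ (1 ≤ p.2 ∧ p.2 ≤ n) := by
  simp [gridA, Finset.mem_product]

theorem Nice.down {d n : ℕ} {I : Finset (ℕ × ℕ)} (hI : Nice d n I) (k i j : ℕ) (hi : 1 ≤ i)
    (h : (i + k, j) ∈ I) : (i, j) ∈ I := by
  induction k with
  | zero => simpa using h
  | succ k ih => exact ih (hI.2.1 (i + k) j (by omega) h)

theorem Nice.down' {d n : ℕ} {I : Finset (ℕ × ℕ)} (hI : Nice d n I) {i i' j : ℕ} (hi : 1 ≤ i)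
    (hii : i ≤ i') (h : (i', j) ∈ I) : (i, j) ∈ I := by
  obtain ⟨k, rfl⟩ := Nat.exists_eq_add_of_le hii
  exact hI.down k i j hi h

theorem disj_col {d n h : ℕ} {I : Finset (ℕ × ℕ)} (hI : Nice d (n - 1) I) :
    Disjoint I (colF h (n + 1)) := by
  rw [Finset.disjoint_left]
  intro p hp hq
  have h1 := mem_gridA.1 (hI.1 hp)
  have h2 := mem_colF.1 hq
  omega

theorem nice_union {d n h : ℕ} {I : Finset (ℕ × ℕ)} (hI : Nice d (n - 1) I) (hd : h ≤ d) :
    Nice d (n + 1) (I ∪ colF h (n + 1)) := by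
  refine ⟨?_, ?_, ?_⟩
  · intro p hp
    rcases Finset.mem_union.1 hp with hp | hp
    · have := mem_gridA.1 (hI.1 hp)
      rw [mem_gridA]; omega
    · have := mem_colF.1 hp
      rw [mem_gridA]; omega
  · intro i j hi hp
    rcases Finset.mem_union.1 hp with hp | hp
    · exact Finset.mem_union_left _ (hI.2.1 i j hi hp)
    · have := mem_colF.1 hp
      refine Finset.mem_union_right _ (mem_colF.2 ?_)
      simp only at this ⊢
      omega
  · intro j hj hjn hp hq
    rcases Finset.mem_union.1 hp with hp | hp
    · have h1 := mem_gridA.1 (hI.1 hp)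
      rcases Finset.mem_union.1 hq with hq | hq
      · have h2 := mem_gridA.1 (hI.1 hq)
        simp only at h1 h2
        exact hI.2.2 j hj (by omega) hp hq
      · have h2 := mem_colF.1 hq
        simp only at h1 h2
        omega
    · have h1 := mem_colF.1 hp
      simp only at h1
      omega

theorem nice_mono {d n : ℕ} {I : Finset (ℕ × ℕ)} :
    Nice d n I ↔ Nice d (n + 1) I ∧ (1, n + 1) ∉ I := by
  constructor
  · intro hI
    refine ⟨⟨?_, hI.2.1, ?_⟩, ?_⟩
    · intro p hp
      have := mem_gridA.1 (hI.1 hp)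
      rw [mem_gridA]; omega
    · intro j hj hjn hp hq
      have := mem_gridA.1 (hI.1 hq)
      simp only at this
      exact hI.2.2 j hj (by omega) hp hq
    · intro hq
      have := mem_gridA.1 (hI.1 hq)
      simp only at this
      omega
  · rintro ⟨hI, hn⟩
    refine ⟨?_, hI.2.1, fun j hj hjn => hI.2.2 j hj (by omega)⟩
    rintro ⟨i, j⟩ hp
    have h1 := mem_gridA.1 (hI.1 hp)
    rw [mem_gridA]
    simp only at h1 ⊢
    have : j ≠ n + 1 := by
      rintro rfl
      exact hn (hI.down' le_rfl h1.1.1 hp)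
    omega

theorem nice_decomp {d n : ℕ} {I : Finset (ℕ × ℕ)} (hI : Nice d (n + 1) I) (h1 : (1, n + 1) ∈ I) :
    ∃ J h, Nice d (n - 1) J ∧ 1 ≤ h ∧ h ≤ d ∧ J ∪ colF h (n + 1) = I := by
  classical
  have hd : 1 ≤ d := (mem_gridA.1 (hI.1 h1)).1.2
  set h := Nat.findGreatest (fun i => (i, n + 1) ∈ I) d with hh
  have hmem : (h, n + 1) ∈ I := Nat.findGreatest_spec (P := fun i => (i, n + 1) ∈ I) hd h1
  have hle : h ≤ d := Nat.findGreatest_le d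
  have hge : 1 ≤ h := Nat.le_findGreatest hd h1
  have hmax : ∀ i, (i, n + 1) ∈ I → i ≤ h := fun i hi =>
    Nat.le_findGreatest (mem_gridA.1 (hI.1 hi)).1.2 hi
  refine ⟨I.filter (fun p => p.2 ≤ n - 1), h, ⟨?_, ?_, ?_⟩, hge, hle, ?_⟩
  · intro p hp
    rw [Finset.mem_filter] at hp
    have := mem_gridA.1 (hI.1 hp.1)
    rw [mem_gridA]; omega
  · intro i j hi hp
    rw [Finset.mem_filter] at hp ⊢
    exact ⟨hI.2.1 i j hi hp.1, hp.2⟩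
  · intro j hj hjn hp hq
    rw [Finset.mem_filter] at hp hq
    exact hI.2.2 j hj (by omega) hp.1 hq.1
  · ext ⟨i, j⟩
    simp only [Finset.mem_union, Finset.mem_filter, mem_colF]
    constructor
    · rintro (h | ⟨⟨ha, hb⟩, rfl⟩)
      · exact h.1
      · exact hI.down' ha hb hmem
    · intro hp
      have hg := mem_gridA.1 (hI.1 hp)
      simp only at hg
      by_cases hj : j = n + 1
      · subst hj
        exact Or.inr ⟨⟨hg.1.1, hmax i hp⟩, rfl⟩
      · have : j ≠ n := by
          rintro rfl
          exact hI.2.2 j hg.2.1 (by omega) (hI.down' le_rfl hg.1.1 hp) h1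
        exact Or.inl ⟨hp, by omega⟩

theorem union_inj {d n h h' : ℕ} {I I' : Finset (ℕ × ℕ)} (hI : Nice d (n - 1) I)
    (hI' : Nice d (n - 1) I') (hh : 1 ≤ h) (hh' : 1 ≤ h')
    (he : I ∪ colF h (n + 1) = I' ∪ colF h' (n + 1)) : I = I' ∧ h = h' := by
  have key : ∀ {h h' : ℕ} {I I' : Finset (ℕ × ℕ)}, Nice d (n - 1) I → Nice d (n - 1) I' →
      1 ≤ h → 1 ≤ h' → I ∪ colF h (n + 1) = I' ∪ colF h' (n + 1) → I ⊆ I' ∧ h ≤ h' := by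
    intro h h' I I' hI hI' hh hh' he
    constructor
    · intro p hp
      have hq : p ∈ I' ∪ colF h' (n + 1) := he ▸ Finset.mem_union_left _ hp
      rcases Finset.mem_union.1 hq with hq | hq
      · exact hq
      · have h1 := mem_gridA.1 (hI.1 hp)
        have h2 := mem_colF.1 hq
        omega
    · have hq : (h, n + 1) ∈ I' ∪ colF h' (n + 1) :=
        he ▸ Finset.mem_union_right _ (mem_colF.2 ⟨⟨hh, le_rfl⟩, rfl⟩)
      rcases Finset.mem_union.1 hq with hq | hq
      · have h1 := mem_gridA.1 (hI'.1 hq)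
        simp only at h1
        omega
      · exact (mem_colF.1 hq).1.2
  have h1 := key hI hI' hh hh' he
  have h2 := key hI' hI hh' hh he.symm
  exact ⟨Finset.Subset.antisymm h1.1 h2.1, le_antisymm h1.2 h2.2⟩

theorem sum_rec (d n : ℕ) (f : Finset (ℕ × ℕ) → ℚ) :
    ∑ I ∈ niceF d (n + 1), f I = ∑ I ∈ niceF d n, f I +
      ∑ I ∈ niceF d (n - 1), ∑ h ∈ Finset.Icc 1 d, f (I ∪ colF h (n + 1)) := by
  classical
  rw [← Finset.sum_filter_not_add_sum_filter (niceF d (n + 1)) (fun I => (1, n + 1) ∈ I)]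
  congr 1
  · apply Finset.sum_congr _ (fun _ _ => rfl)
    ext I
    rw [Finset.mem_filter, mem_niceF, mem_niceF]
    exact nice_mono.symm
  · rw [← Finset.sum_product']
    symm
    refine Finset.sum_bij (fun q _ => q.1 ∪ colF q.2 (n + 1)) ?_ ?_ ?_ ?_
    · rintro ⟨I, h⟩ hq
      simp only [Finset.mem_product, mem_niceF, Finset.mem_Icc] at hq
      rw [Finset.mem_filter, mem_niceF]
      exact ⟨nice_union hq.1 hq.2.2, Finset.mem_union_right _ (mem_colF.2 ⟨⟨le_rfl, hq.2.1⟩, rfl⟩)⟩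
    · rintro ⟨I, h⟩ hq ⟨I', h'⟩ hq' he
      simp only [Finset.mem_product, mem_niceF, Finset.mem_Icc] at hq hq' he
      obtain ⟨h1, h2⟩ := union_inj hq.1 hq'.1 hq.2.1 hq'.2.1 he
      rw [h1, h2]
    · intro I hI
      rw [Finset.mem_filter, mem_niceF] at hI
      obtain ⟨J, h, hJ, h1, h2, h3⟩ := nice_decomp hI.1 hI.2
      exact ⟨(J, h), by simp [mem_niceF, hJ, h1, h2], h3⟩
    · intro _ _
      rfl

/-- weight of a column of height `h` -/
def wcol (m j : ℕ) (h : ℚ) : ℚ := m * h * (h - 1) / 2 + j * h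

theorem sigma_col (m h j : ℕ) : (sigmaW m (colF h j) : ℚ) = wcol m j h := by
  have : sigmaW m (colF h j) = ∑ i ∈ Finset.Icc 1 h, ((i - 1) * m + j) := by
    simp [sigmaW, colF, Finset.sum_product]
  rw [this]
  clear this
  induction h with
  | zero => simp [wcol]
  | succ h ih =>
    rw [Finset.sum_Icc_succ_top (by omega), Nat.cast_add, ih]
    simp only [wcol, Nat.add_sub_cancel]
    push_cast
    ring

theorem card_col (h j : ℕ) : (colF h j).card = h := by simp [colF]

noncomputable def GG (m n a b d : ℕ) : ℚ :=
  ∑ I ∈ niceF d n, (sigmaW m I : ℚ) ^ a * (I.card : ℚ) ^ b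

noncomputable def TT (m j a b d : ℕ) : ℚ :=
  ∑ h ∈ Finset.Icc 1 d, (wcol m j h) ^ a * (h : ℚ) ^ b

theorem GG_rec (m n a b d : ℕ) : GG m (n + 1) a b d = GG m n a b d +
    ∑ i ∈ Finset.range (a + 1), ∑ j ∈ Finset.range (b + 1),
      ((a.choose i : ℚ) * (b.choose j : ℚ)) *
        (GG m (n - 1) i j d * TT m (n + 1) (a - i) (b - j) d) := by
  rw [GG, sum_rec, ← GG]
  congr 1
  have h1 : ∀ I ∈ niceF d (n - 1), ∀ h ∈ Finset.Icc 1 d,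
      (sigmaW m (I ∪ colF h (n + 1)) : ℚ) ^ a * ((I ∪ colF h (n + 1)).card : ℚ) ^ b =
      ∑ i ∈ Finset.range (a + 1), ∑ j ∈ Finset.range (b + 1),
      ((a.choose i : ℚ) * (b.choose j : ℚ)) *
        (((sigmaW m I : ℚ) ^ i * (I.card : ℚ) ^ j) *
          ((wcol m (n + 1 : ℕ) h) ^ (a - i) * (h : ℚ) ^ (b - j))) := by
    intro I hI h _
    have hdis := disj_col (h := h) (mem_niceF.1 hI)
    have hs : (sigmaW m (I ∪ colF h (n + 1)) : ℚ) = sigmaW m I + wcol m (n + 1 : ℕ) h := by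
      rw [← sigma_col]
      simp only [sigmaW]
      rw [Finset.sum_union hdis]
      push_cast
      rfl
    rw [hs, Finset.card_union_of_disjoint hdis, card_col, Nat.cast_add, add_pow, add_pow,
      Finset.sum_mul_sum]
    refine Finset.sum_congr rfl fun i _ => Finset.sum_congr rfl fun j _ => ?_
    ring
  rw [Finset.sum_congr rfl fun I hI => Finset.sum_congr rfl (h1 I hI)]
  have h2 : ∀ I ∈ niceF d (n - 1), (∑ h ∈ Finset.Icc 1 d,
      ∑ i ∈ Finset.range (a + 1), ∑ j ∈ Finset.range (b + 1),
      ((a.choose i : ℚ) * (b.choose j : ℚ)) *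
        (((sigmaW m I : ℚ) ^ i * (I.card : ℚ) ^ j) *
          ((wcol m (n + 1 : ℕ) h) ^ (a - i) * (h : ℚ) ^ (b - j)))) =
      ∑ i ∈ Finset.range (a + 1), ∑ j ∈ Finset.range (b + 1),
      ((a.choose i : ℚ) * (b.choose j : ℚ)) *
        (((sigmaW m I : ℚ) ^ i * (I.card : ℚ) ^ j) * TT m (n + 1) (a - i) (b - j) d) := by
    intro I _
    rw [Finset.sum_comm]
    refine Finset.sum_congr rfl fun i _ => ?_
    rw [Finset.sum_comm]
    refine Finset.sum_congr rfl fun j _ => ?_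
    rw [← Finset.mul_sum, ← Finset.mul_sum, TT]
  rw [Finset.sum_congr rfl h2, Finset.sum_comm]
  refine Finset.sum_congr rfl fun i _ => ?_
  rw [Finset.sum_comm]
  refine Finset.sum_congr rfl fun j _ => ?_
  rw [← Finset.mul_sum, ← Finset.sum_mul, GG]

open Polynomial in
def PP (k : ℕ) (c : ℚ) (f : ℕ → ℚ) : Prop :=
  ∃ p : ℚ[X], p.natDegree ≤ k ∧ p.coeff k = c ∧ ∀ d : ℕ, f d = p.eval (d : ℚ)

theorem PP.add {k : ℕ} {c c' : ℚ} {f g : ℕ → ℚ} (hf : PP k c f) (hg : PP k c' g) :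
    PP k (c + c') (fun d => f d + g d) := by
  obtain ⟨p, h1, h2, h3⟩ := hf
  obtain ⟨q, h4, h5, h6⟩ := hg
  exact ⟨p + q, Polynomial.natDegree_add_le_of_degree_le h1 h4, by simp [h2, h5],
    fun d => by simp [h3, h6]⟩

theorem PP.mul {k l : ℕ} {c c' : ℚ} {f g : ℕ → ℚ} (hf : PP k c f) (hg : PP l c' g) :
    PP (k + l) (c * c') (fun d => f d * g d) := by
  obtain ⟨p, h1, h2, h3⟩ := hf
  obtain ⟨q, h4, h5, h6⟩ := hg
  exact ⟨p * q, Polynomial.natDegree_mul_le_of_le h1 h4,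
    by rw [Polynomial.coeff_mul_add_eq_of_natDegree_le h1 h4, h2, h5],
    fun d => by simp [h3, h6]⟩

theorem PP.smul {k : ℕ} {c : ℚ} {f : ℕ → ℚ} (r : ℚ) (hf : PP k c f) :
    PP k (r * c) (fun d => r * f d) := by
  obtain ⟨p, h1, h2, h3⟩ := hf
  exact ⟨Polynomial.C r * p, (Polynomial.natDegree_C_mul_le _ _).trans h1, by simp [h2],
    fun d => by simp [h3]⟩

theorem PP.raise {k l : ℕ} {c : ℚ} {f : ℕ → ℚ} (hf : PP k c f) (hkl : k < l) : PP l 0 f := by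
  obtain ⟨p, h1, h2, h3⟩ := hf
  exact ⟨p, by omega, Polynomial.coeff_eq_zero_of_natDegree_lt (by omega), h3⟩

theorem PP.zero (k : ℕ) : PP k 0 (fun _ => 0) := ⟨0, by simp, by simp, by simp⟩

theorem PP.sum {ι : Type} (s : Finset ι) {k : ℕ} {c : ι → ℚ} {f : ι → ℕ → ℚ}
    (h : ∀ i ∈ s, PP k (c i) (f i)) : PP k (∑ i ∈ s, c i) (fun d => ∑ i ∈ s, f i d) := by
  classical
  induction s using Finset.induction_on with
  | empty => simpa using PP.zero k
  | insert i s hi ih =>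
    simp only [Finset.sum_insert hi]
    exact (h i (Finset.mem_insert_self _ _)).add
      (ih fun j hj => h j (Finset.mem_insert_of_mem hj))

theorem PP_pow_sum (k : ℕ) :
    PP (k + 1) (1 / (k + 1)) (fun d => ∑ h ∈ Finset.Icc 1 d, (h : ℚ) ^ k) := by
  have h0 : ∀ i ∈ Finset.range (k + 1), PP (k + 1) (if i = 0 then 1 / ((k : ℚ) + 1) else 0)
      (fun d => bernoulli' i * ((k + 1).choose i : ℚ) * (d : ℚ) ^ (k + 1 - i) / (k + 1)) := by
    intro i hi
    refine ⟨Polynomial.C (bernoulli' i * ((k + 1).choose i : ℚ) / (k + 1)) *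
      Polynomial.X ^ (k + 1 - i), ?_, ?_, ?_⟩
    · exact (Polynomial.natDegree_C_mul_X_pow_le _ _).trans (by omega)
    · rw [Polynomial.coeff_C_mul_X_pow]
      by_cases h : i = 0
      · subst h; simp
      · rw [if_neg h, if_neg (by omega)]
    · intro d
      simp
      ring
  have h1 := PP.sum _ h0
  rw [Finset.sum_ite_eq' (Finset.range (k + 1)) 0] at h1
  simp only [Finset.mem_range, Nat.succ_pos', if_true] at h1
  convert h1 using 2 with d
  rw [← sum_Ico_pow]
  rfl

theorem PP.isum {k : ℕ} {c : ℚ} {p : Polynomial ℚ} (h1 : p.natDegree ≤ k) (h2 : p.coeff k = c) :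
    PP (k + 1) (c / (k + 1)) (fun d => ∑ h ∈ Finset.Icc 1 d, p.eval (h : ℚ)) := by
  have h0 : ∀ i ∈ Finset.range (k + 1), PP (k + 1) (if i = k then c / ((k : ℚ) + 1) else 0)
      (fun d => p.coeff i * ∑ h ∈ Finset.Icc 1 d, (h : ℚ) ^ i) := by
    intro i hi
    rw [Finset.mem_range] at hi
    by_cases h : i = k
    · subst h
      have := (PP_pow_sum i).smul (p.coeff i)
      rw [h2] at this
      rw [if_pos rfl, h2]
      convert this using 1
      ring
    · rw [if_neg h]
      have := (PP_pow_sum i).smul (p.coeff i)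
      exact this.raise (by omega)
  have h3 := PP.sum _ h0
  rw [Finset.sum_ite_eq' (Finset.range (k + 1)) k, if_pos (by simp)] at h3
  convert h3 using 2 with d
  simp only [Finset.mul_sum]
  rw [Finset.sum_comm]
  refine Finset.sum_congr rfl fun h _ => ?_
  rw [Polynomial.eval_eq_sum_range' (Nat.lt_succ_of_le h1)]

theorem PP_TT (m j a b : ℕ) (hm : 1 ≤ m) :
    ∃ c, 0 < c ∧ PP (2 * a + b + 1) c (TT m j a b) := by
  open Polynomial in
  let w : ℚ[X] := C ((m : ℚ) / 2) * X ^ 2 + C ((j : ℚ) - m / 2) * X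
  have hw1 : w.natDegree ≤ 2 := by
    simp only [w]; compute_degree
  have hw2 : w.coeff 2 = (m : ℚ) / 2 := by
    simp only [w]
    simp [Polynomial.coeff_X]
  have hw3 : ∀ h : ℕ, w.eval (h : ℚ) = wcol m j h := by
    intro h
    simp [w, wcol]
    ring
  have ha1 : (w ^ a).natDegree ≤ a * 2 := Polynomial.natDegree_pow_le_of_le a hw1
  have ha2 : (w ^ a).coeff (a * 2) = ((m : ℚ) / 2) ^ a := by
    rw [Polynomial.coeff_pow_of_natDegree_le hw1, hw2]
  have hX1 : ((Polynomial.X : Polynomial ℚ) ^ b).natDegree ≤ b := by simp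
  have h1 := Polynomial.natDegree_mul_le_of_le ha1 hX1
  have h2 := Polynomial.coeff_mul_add_eq_of_natDegree_le ha1 hX1
  rw [ha2, Polynomial.coeff_X_pow_self, mul_one] at h2
  have h3 := PP.isum h1 h2
  have hmq : (0 : ℚ) < m := by exact_mod_cast hm
  refine ⟨((m : ℚ) / 2) ^ a / (((a * 2 + b : ℕ) : ℚ) + 1), by positivity, ?_⟩
  rw [mul_comm 2 a]
  convert h3 using 2 with d
  simp only [TT, Polynomial.eval_mul, Polynomial.eval_pow, Polynomial.eval_X, hw3]

theorem niceF_zero (d : ℕ) : niceF d 0 = {∅} := by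
  ext I
  rw [mem_niceF, Finset.mem_singleton]
  constructor
  · intro h
    rw [← Finset.subset_empty]
    simpa [gridA] using h.1
  · rintro rfl
    exact ⟨by simp, by simp, by simp⟩

theorem PP_GG_zero (m a b : ℕ) :
    ∃ c, 0 ≤ c ∧ (a = 0 ∧ b = 0 → 0 < c) ∧ PP (2 * a + b) c (GG m 0 a b) := by
  have h : GG m 0 a b = fun _ => (0 : ℚ) ^ (a + b) := by
    funext d
    simp [GG, niceF_zero, sigmaW, pow_add]
  by_cases h0 : a = 0 ∧ b = 0
  · obtain ⟨rfl, rfl⟩ := h0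
    exact ⟨1, by norm_num, by simp, 1, by simp, by simp, by simp [h]⟩
  · refine ⟨0, le_rfl, fun h' => absurd h' h0, ?_⟩
    rw [h, zero_pow (by omega)]
    exact PP.zero _

theorem PP_GG (m : ℕ) (hm : 1 ≤ m) (n : ℕ) : ∀ a b : ℕ,
    ∃ c, 0 ≤ c ∧ (1 ≤ n ∨ (a = 0 ∧ b = 0) → 0 < c) ∧
      PP (2 * a + b + (n + 1) / 2) c (GG m n a b) := by
  induction n using Nat.strong_induction_on with
  | _ n ih =>
    intro a b
    rcases n with _ | n
    · simpa using PP_GG_zero m a b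
    obtain ⟨c₁, hc₁, -, hP₁⟩ := ih n (by omega) a b
    have hP₁' : ∃ c, 0 ≤ c ∧ PP (2 * a + b + (n + 1 + 1) / 2) c (GG m n a b) := by
      by_cases he : (n + 1) / 2 = (n + 1 + 1) / 2
      · rw [← he]; exact ⟨c₁, hc₁, hP₁⟩
      · exact ⟨0, le_rfl, hP₁.raise (by omega)⟩
    obtain ⟨c₂, hc₂, hP₂⟩ := hP₁'
    choose cG hG0 hG1 hG2 using ih (n - 1) (by omega)
    choose cT hT0 hT1 using fun a b => PP_TT m (n + 1) a b hm
    have key : ∀ i ∈ Finset.range (a + 1), ∀ j ∈ Finset.range (b + 1),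
        PP (2 * a + b + (n + 1 + 1) / 2)
          (((a.choose i : ℚ) * (b.choose j : ℚ)) * (cG i j * cT (a - i) (b - j)))
          (fun d => ((a.choose i : ℚ) * (b.choose j : ℚ)) *
            (GG m (n - 1) i j d * TT m (n + 1) (a - i) (b - j) d)) := by
      intro i hi j hj
      rw [Finset.mem_range] at hi hj
      have := ((hG2 i j).mul (hT1 (a - i) (b - j))).smul ((a.choose i : ℚ) * (b.choose j : ℚ))
      convert this using 1
      omega
    have hS := PP.sum _ fun i hi => PP.sum _ (key i hi)
    have hnn : ∀ i j, 0 ≤ ((a.choose i : ℚ) * (b.choose j : ℚ)) *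
        (cG i j * cT (a - i) (b - j)) := fun i j =>
      mul_nonneg (by positivity) (mul_nonneg (hG0 i j) (hT0 _ _).le)
    have hpos : 0 < ∑ i ∈ Finset.range (a + 1), ∑ j ∈ Finset.range (b + 1),
        ((a.choose i : ℚ) * (b.choose j : ℚ)) * (cG i j * cT (a - i) (b - j)) := by
      refine Finset.sum_pos' (fun i _ => Finset.sum_nonneg fun j _ => hnn i j)
        ⟨0, by simp, Finset.sum_pos' (fun j _ => hnn 0 j) ⟨0, by simp, ?_⟩⟩
      have := mul_pos (hG1 0 0 (Or.inr ⟨rfl, rfl⟩)) (hT0 (a - 0) (b - 0))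
      simpa using this
    refine ⟨_, (add_pos_of_nonneg_of_pos hc₂ hpos).le,
      fun _ => add_pos_of_nonneg_of_pos hc₂ hpos, ?_⟩
    have := hP₂.add hS
    convert this using 1
    funext d
    exact GG_rec m n a b d

theorem stmt17 (m n a b : ℕ) (hm : 1 ≤ m) (hn : 1 ≤ n) (hab : 1 ≤ a + b) :
    ∃ p : Polynomial ℚ, p.natDegree = 2 * a + b + (n + 1) / 2 ∧
      ∀ d : ℕ, 1 ≤ d →
        (∑ᶠ I ∈ {I : Finset (ℕ × ℕ) | Nice d n I},
            ((sigmaW m I : ℚ) ^ a * (I.card : ℚ) ^ b)) = p.eval (d : ℚ) := by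
  obtain ⟨c, -, hc, p, h1, h2, h3⟩ := PP_GG m hm n a b
  refine ⟨p, le_antisymm h1 (Polynomial.le_natDegree_of_ne_zero ?_), fun d _ => ?_⟩
  · rw [h2]; exact (hc (Or.inl hn)).ne'
  · rw [← h3, GG]
    have : {I : Finset (ℕ × ℕ) | Nice d n I} = ↑(niceF d n) := by
      ext I
      simp [mem_niceF]
    rw [this, finsum_mem_coe_finset]
end
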